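/- Let n ≥ 2, let U ⊆ ℝ^n and I ⊆ ℝ be open sets, let P : U → ℝ^n be a smooth map whose derivative has rank n at every point of U, and let φ : I → ℝ^n be a smooth map such that for every t ∈ I one has φ(t) ≠ 0 and φ'(t) is not parallel to φ(t) (i.e., φ(t) and φ'(t) are linearly independent). Define f(x,y) = Σ_{k=1}^{n} P_k(x)·φ_k(y) for x ∈ U, y ∈ I. If A ⊆ U and B ⊆ I are compact sets with dim_H A + dim_H B > n, then there exists y ∈ B such that the set f(A,y) = { f(x,y) : x ∈ A } has positive one-dimensional Lebesgue measure. -/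

import Mathlib

open MeasureTheory
open scoped ENNReal

section Frostman

variable {X : Type*} [MetricSpace X]

/-- If every finite cover of `X` by balls has `s`-content at least `c`, then so has, up to a
constant, every finite cover with integer multiplicities. -/
lemma natCast_mul_le_sum_of_multicover {s c : ℝ}
    (hc : ∀ (ι : Type) [Fintype ι] (x : ι → X) (r : ι → ℝ), (∀ i, 0 < r i) →
      (∀ z, ∃ i, dist z (x i) ≤ r i) → c ≤ ∑ i, r i ^ s)
    {ι : Type} [Fintype ι] (x : ι → X) (r : ι → ℝ) (hr : ∀ i, 0 < r i) (m : ℕ) (k : ι → ℕ)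
    (hk : ∀ z, m ≤ ∑ i, if dist z (x i) ≤ r i then k i else 0) :
    m * c ≤ ∑ i, k i * (4 * r i) ^ s := by
  classical
  induction m generalizing k with
  | zero =>
    rw [Nat.cast_zero, zero_mul]
    exact Finset.sum_nonneg fun i _ => by have := hr i; positivity
  | succ m ih =>
    obtain ⟨R, hR⟩ : ∃ R, ∀ i, r i ≤ R :=
      ⟨∑ i, r i, fun i => Finset.single_le_sum (fun j _ => (hr j).le) (Finset.mem_univ i)⟩
    obtain ⟨u, hut, hdisj, hcov⟩ :=
      Vitali.exists_disjoint_subfamily_covering_enlargement_closedBall {i | 0 < k i} x r R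
        (fun i _ => hR i) 4 (by norm_num)
    have hsum : c ≤ ∑ i ∈ Finset.univ.filter (· ∈ u), (4 * r i) ^ s := by
      have := hc {i // i ∈ u} (fun i => x i) (fun i => 4 * r i)
        (fun i => by have := hr i; positivity) ?_
      · refine this.trans (le_of_eq ?_)
        exact (Finset.sum_subtype _ (by simp) (fun i => (4 * r i) ^ s)).symm
      · intro z
        have hz := (Nat.succ_pos m).trans_le (hk z)
        obtain ⟨i, -, hi⟩ := Finset.exists_ne_zero_of_sum_ne_zero hz.ne'
        split_ifs at hi with hzi
        · obtain ⟨b, hb, hsub⟩ := hcov i (Nat.pos_of_ne_zero hi)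
          exact ⟨⟨b, hb⟩, hsub hzi⟩
        · exact absurd rfl hi
    have hk' : ∀ i, k i = (k i - if i ∈ u then 1 else 0) + if i ∈ u then 1 else 0 := by
      intro i
      split_ifs with hi
      · have : 0 < k i := hut hi
        omega
      · omega
    have key := ih (fun i => k i - if i ∈ u then 1 else 0) fun z => by
      have h1 := hk z
      have h2 : (∑ i, if dist z (x i) ≤ r i then k i else 0) =
          (∑ i, if dist z (x i) ≤ r i then (k i - if i ∈ u then 1 else 0) else 0) +
            ∑ i, if dist z (x i) ≤ r i then (if i ∈ u then 1 else 0) else 0 := by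
        rw [← Finset.sum_add_distrib]
        refine Finset.sum_congr rfl fun i _ => ?_
        split_ifs with h h'
        · have : 0 < k i := hut h'
          omega
        · rfl
        · rfl
      have h3 : (∑ i, if dist z (x i) ≤ r i then (if i ∈ u then 1 else 0) else 0) ≤ 1 := by
        simp_rw [← ite_and]
        rw [Finset.sum_boole, Nat.cast_id, Finset.card_le_one]
        intro a ha b hb
        simp only [Finset.mem_filter, Finset.mem_univ, true_and] at ha hb
        by_contra hab
        exact Set.disjoint_left.1 (hdisj ha.2 hb.2 hab) (Metric.mem_closedBall.2 ha.1)
          (Metric.mem_closedBall.2 hb.1)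
      omega
    calc ((m + 1 : ℕ) : ℝ) * c = m * c + c := by push_cast; ring
      _ ≤ (∑ i, ((k i - if i ∈ u then 1 else 0 : ℕ) : ℝ) * (4 * r i) ^ s) +
          ∑ i ∈ Finset.univ.filter (· ∈ u), (4 * r i) ^ s := add_le_add key hsum
      _ = _ := by
          rw [Finset.sum_filter, ← Finset.sum_add_distrib]
          refine Finset.sum_congr rfl fun i _ => ?_
          conv_rhs => rw [hk' i]
          split_ifs <;> push_cast <;> ring

lemma le_sum_of_weighted_cover {s c : ℝ}
    (hc : ∀ (ι : Type) [Fintype ι] (x : ι → X) (r : ι → ℝ), (∀ i, 0 < r i) →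
      (∀ z, ∃ i, dist z (x i) ≤ r i) → c ≤ ∑ i, r i ^ s)
    {ι : Type} [Fintype ι] (x : ι → X) (r : ι → ℝ) (hr : ∀ i, 0 < r i) (w : ι → ℝ)
    (hw : ∀ i, 0 ≤ w i) (hk : ∀ z, 1 ≤ ∑ i, if dist z (x i) ≤ r i then w i else 0) :
    c ≤ ∑ i, w i * (4 * r i) ^ s := by
  have key : ∀ M : ℕ, c ≤ (∑ i, w i * (4 * r i) ^ s) +
      (∑ i, (4 * r i) ^ s) * (1 / ((M : ℝ) + 1)) := by
    intro M
    have hM : (0 : ℝ) < (M : ℝ) + 1 := by positivity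
    have h1 := natCast_mul_le_sum_of_multicover hc x r hr (M + 1)
      (fun i => ⌈((M : ℝ) + 1) * w i⌉₊) fun z => by
        have : ((M : ℝ) + 1) * 1 ≤ ∑ i, if dist z (x i) ≤ r i then
            (⌈((M : ℝ) + 1) * w i⌉₊ : ℝ) else 0 := by
          refine (mul_le_mul_of_nonneg_left (hk z) hM.le).trans ?_
          rw [Finset.mul_sum]
          refine Finset.sum_le_sum fun i _ => ?_
          split_ifs
          · exact Nat.le_ceil _
          · simp
        rw [mul_one] at this
        exact_mod_cast this
    have h2 : ∑ i, (⌈((M : ℝ) + 1) * w i⌉₊ : ℝ) * (4 * r i) ^ s ≤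
        ∑ i, (((M : ℝ) + 1) * w i + 1) * (4 * r i) ^ s := by
      refine Finset.sum_le_sum fun i _ => ?_
      have := hr i
      gcongr
      exact (Nat.ceil_lt_add_one (mul_nonneg hM.le (hw i))).le
    have h3 : ∑ i, (((M : ℝ) + 1) * w i + 1) * (4 * r i) ^ s =
        ((M : ℝ) + 1) * (∑ i, w i * (4 * r i) ^ s) + ∑ i, (4 * r i) ^ s := by
      rw [Finset.mul_sum, ← Finset.sum_add_distrib]
      exact Finset.sum_congr rfl fun i _ => by ring
    push_cast at h1
    have h4 := h1.trans (h2.trans h3.le)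
    rw [mul_one_div, ← sub_le_iff_le_add', le_div_iff₀ hM]
    linarith
  have hlim : Filter.Tendsto (fun M : ℕ => (∑ i, w i * (4 * r i) ^ s) +
      (∑ i, (4 * r i) ^ s) * (1 / ((M : ℝ) + 1))) Filter.atTop
      (nhds ((∑ i, w i * (4 * r i) ^ s) + (∑ i, (4 * r i) ^ s) * 0)) :=
    (tendsto_one_div_add_atTop_nhds_zero_nat.const_mul _).const_add _
  have := ge_of_tendsto' hlim key
  simpa using this

lemma exists_pos_le_sum_of_cover [MeasurableSpace X] [BorelSpace X] {s : ℝ} (hs : 0 < s)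
    (h : Measure.hausdorffMeasure s (Set.univ : Set X) ≠ 0) :
    ∃ c > 0, ∀ (ι : Type) [Fintype ι] (x : ι → X) (r : ι → ℝ), (∀ i, 0 < r i) →
      (∀ z, ∃ i, dist z (x i) ≤ r i) → c ≤ ∑ i, r i ^ s := by
  by_contra hcon
  push Not at hcon
  have hpos : ∀ j : ℕ, (0 : ℝ) < 1 / ((j : ℝ) + 1) := fun j => by positivity
  choose ι hι x r hr hcov hlt using fun j : ℕ => hcon (1 / ((j : ℝ) + 1)) (hpos j)
  refine h (le_antisymm ?_ zero_le)
  have hlim : Filter.Tendsto (fun j : ℕ => ENNReal.ofReal (1 / ((j : ℝ) + 1))) Filter.atTop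
      (nhds 0) := by
    simpa using ENNReal.tendsto_ofReal (tendsto_one_div_add_atTop_nhds_zero_nat (𝕜 := ℝ))
  have hdiam : ∀ j i, Metric.ediam (Metric.closedBall (x j i) (r j i)) ≤
      ENNReal.ofReal (2 * r j i) := by
    intro j i
    refine Metric.ediam_le_of_forall_dist_le fun a ha b hb => ?_
    have h1 := dist_triangle_right a b (x j i)
    have h2 := Metric.mem_closedBall.1 ha
    have h3 := Metric.mem_closedBall.1 hb
    linarith
  have hsmall : ∀ j i, r j i ≤ (1 / ((j : ℝ) + 1)) ^ (1 / s) := by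
    intro j i
    have h1 : r j i ^ s ≤ 1 / ((j : ℝ) + 1) :=
      (Finset.single_le_sum (f := fun i => r j i ^ s)
        (fun i _ => by have := hr j i; positivity) (Finset.mem_univ i)).trans (hlt j).le
    calc r j i = (r j i ^ s) ^ (1 / s) := by
          rw [← Real.rpow_mul (hr j i).le, mul_one_div_cancel hs.ne', Real.rpow_one]
      _ ≤ _ := Real.rpow_le_rpow (by have := hr j i; positivity) h1 (by positivity)
  refine (Measure.hausdorffMeasure_le_liminf_sum (l := Filter.atTop) s Set.univ
    (fun j : ℕ => ENNReal.ofReal (2 * (1 / ((j : ℝ) + 1)) ^ (1 / s))) ?_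
    (fun j i => Metric.closedBall (x j i) (r j i)) ?_ ?_).trans ?_
  · have h1 : Filter.Tendsto (fun j : ℕ => 2 * (1 / ((j : ℝ) + 1)) ^ (1 / s)) Filter.atTop
        (nhds (2 * 0 ^ (1 / s))) :=
      (((tendsto_one_div_add_atTop_nhds_zero_nat (𝕜 := ℝ)).rpow_const
        (Or.inr (by positivity))).const_mul 2)
    rw [Real.zero_rpow (by positivity), mul_zero] at h1
    simpa using ENNReal.tendsto_ofReal h1
  · refine Filter.Eventually.of_forall fun j i => (hdiam j i).trans ?_
    refine ENNReal.ofReal_le_ofReal ?_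
    have := hsmall j i
    linarith
  · refine Filter.Eventually.of_forall fun j z _ => ?_
    obtain ⟨i, hi⟩ := hcov j z
    exact Set.mem_iUnion.2 ⟨i, hi⟩
  · have hlim2 : Filter.Tendsto (fun j : ℕ => ENNReal.ofReal (2 ^ s) *
        ENNReal.ofReal (1 / ((j : ℝ) + 1))) Filter.atTop (nhds 0) := by
      simpa using ENNReal.Tendsto.const_mul hlim (Or.inr ENNReal.ofReal_ne_top)
        (a := ENNReal.ofReal (2 ^ s))
    refine (Filter.liminf_le_liminf (Filter.Eventually.of_forall fun j => ?_)).trans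
      hlim2.liminf_eq.le
    calc ∑ i, Metric.ediam (Metric.closedBall (x j i) (r j i)) ^ s
        ≤ ∑ i, ENNReal.ofReal (2 ^ s) * ENNReal.ofReal (r j i ^ s) := by
          refine Finset.sum_le_sum fun i _ => ?_
          have hri := hr j i
          refine (ENNReal.rpow_le_rpow (hdiam j i) hs.le).trans (le_of_eq ?_)
          rw [ENNReal.ofReal_rpow_of_nonneg (by positivity) hs.le,
            Real.mul_rpow (by norm_num) hri.le, ENNReal.ofReal_mul (by positivity)]
      _ = ENNReal.ofReal (2 ^ s) * ENNReal.ofReal (∑ i, r j i ^ s) := by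
          rw [← Finset.mul_sum, ENNReal.ofReal_sum_of_nonneg]
          intro i _
          have := hr j i
          positivity
      _ ≤ _ := by
          gcongr
          exact (hlt j).le

/-- The values of the weighted covers by balls of the function `f`. -/
def weightedCoverSums (s : ℝ) (f : C(X, ℝ)) : Set ℝ :=
  {v | ∃ (ι : Type) (_ : Fintype ι) (x : ι → X) (r w : ι → ℝ), (∀ i, 0 < r i) ∧ (∀ i, 0 ≤ w i) ∧
    (∀ z, f z ≤ ∑ i, if dist z (x i) ≤ r i then w i else 0) ∧ v = ∑ i, w i * r i ^ s}

lemma weightedCoverSums_nonneg {s : ℝ} {f : C(X, ℝ)} {v : ℝ} (hv : v ∈ weightedCoverSums s f) :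
    0 ≤ v := by
  obtain ⟨ι, _, x, r, w, hr, hw, -, rfl⟩ := hv
  exact Finset.sum_nonneg fun i _ => mul_nonneg (hw i) (Real.rpow_nonneg (hr i).le s)

lemma bddBelow_weightedCoverSums (s : ℝ) (f : C(X, ℝ)) : BddBelow (weightedCoverSums s f) :=
  ⟨0, fun _ hv => weightedCoverSums_nonneg hv⟩

lemma weightedCoverSums_nonempty [CompactSpace X] [Nonempty X] (s : ℝ) (f : C(X, ℝ)) :
    (weightedCoverSums s f).Nonempty := by
  obtain ⟨x₀⟩ := ‹Nonempty X›
  refine ⟨_, Unit, inferInstance, fun _ => x₀, fun _ => Metric.diam (Set.univ : Set X) + 1,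
    fun _ => ‖f‖, fun _ => by have := Metric.diam_nonneg (s := (Set.univ : Set X)); positivity,
    fun _ => norm_nonneg f, fun z => ?_, rfl⟩
  have h : dist z x₀ ≤ Metric.diam (Set.univ : Set X) + 1 :=
    (Metric.dist_le_diam_of_mem isCompact_univ.isBounded trivial trivial).trans (by linarith)
  simp only [h, if_true, Finset.sum_const, Finset.card_univ, Fintype.card_unit, one_smul]
  exact (le_abs_self _).trans (f.norm_coe_le_norm z)

lemma add_mem_weightedCoverSums {s : ℝ} {f g : C(X, ℝ)} {v v' : ℝ}
    (hv : v ∈ weightedCoverSums s f) (hv' : v' ∈ weightedCoverSums s g) :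
    v + v' ∈ weightedCoverSums s (f + g) := by
  obtain ⟨ι, _, x, r, w, hr, hw, hf, rfl⟩ := hv
  obtain ⟨ι', _, x', r', w', hr', hw', hf', rfl⟩ := hv'
  refine ⟨ι ⊕ ι', inferInstance, Sum.elim x x', Sum.elim r r', Sum.elim w w', ?_, ?_, ?_, ?_⟩
  · rintro (i | i)
    exacts [hr i, hr' i]
  · rintro (i | i)
    exacts [hw i, hw' i]
  · intro z
    rw [Fintype.sum_sum_type]
    exact add_le_add (hf z) (hf' z)
  · rw [Fintype.sum_sum_type]
    rfl

lemma smul_mem_weightedCoverSums {s : ℝ} {f : C(X, ℝ)} {v c : ℝ} (hc : 0 ≤ c)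
    (hv : v ∈ weightedCoverSums s f) : c * v ∈ weightedCoverSums s (c • f) := by
  obtain ⟨ι, _, x, r, w, hr, hw, hf, rfl⟩ := hv
  refine ⟨ι, inferInstance, x, r, fun i => c * w i, hr, fun i => mul_nonneg hc (hw i), ?_, ?_⟩
  · intro z
    have := mul_le_mul_of_nonneg_left (hf z) hc
    rw [Finset.mul_sum] at this
    simpa [mul_ite] using this
  · rw [Finset.mul_sum]
    exact Finset.sum_congr rfl fun i _ => by ring

lemma exists_positive_functional [CompactSpace X] [MeasurableSpace X] [BorelSpace X] {s : ℝ}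
    (hs : 0 < s) (h : Measure.hausdorffMeasure s (Set.univ : Set X) ≠ 0) :
    ∃ g : C(X, ℝ) →ₗ[ℝ] ℝ, (∀ f : C(X, ℝ), (∀ z, 0 ≤ f z) → 0 ≤ g f) ∧ 0 < g 1 ∧
      ∀ (f : C(X, ℝ)) (x : X) (r : ℝ), 0 < r → (∀ z, f z ≤ if dist z x ≤ r then 1 else 0) →
        g f ≤ r ^ s := by
  have : Nonempty X := by
    by_contra hX
    rw [not_nonempty_iff] at hX
    exact h (by rw [Set.univ_eq_empty_iff.2 hX, measure_empty])
  obtain ⟨c, hc, hcov⟩ := exists_pos_le_sum_of_cover hs h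
  set p : C(X, ℝ) → ℝ := fun f => sInf (weightedCoverSums s f) with hp
  have hple : ∀ {f v}, v ∈ weightedCoverSums s f → p f ≤ v := fun hv =>
    csInf_le (bddBelow_weightedCoverSums s _) hv
  have hp1 : 0 < p 1 := by
    refine lt_of_lt_of_le (show 0 < c / 4 ^ s by positivity)
      (le_csInf (weightedCoverSums_nonempty s 1) ?_)
    rintro v ⟨ι, _, x, r, w, hr, hw, hf, rfl⟩
    have := le_sum_of_weighted_cover hcov x r hr w hw hf
    rw [div_le_iff₀' (by positivity), Finset.mul_sum]
    refine this.trans (le_of_eq (Finset.sum_congr rfl fun i _ => ?_))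
    rw [Real.mul_rpow (by norm_num) (hr i).le]
    ring
  have hsmul_le : ∀ a : ℝ, 0 < a → ∀ f, p (a • f) ≤ a * p f := by
    intro a ha f
    rw [← div_le_iff₀' ha]
    refine le_csInf (weightedCoverSums_nonempty s f) fun v hv => ?_
    rw [div_le_iff₀' ha]
    exact hple (smul_mem_weightedCoverSums ha.le hv)
  have hsmul : ∀ a : ℝ, 0 < a → ∀ f, p (a • f) = a * p f := by
    intro a ha f
    refine le_antisymm (hsmul_le a ha f) ?_
    have := hsmul_le a⁻¹ (inv_pos.2 ha) (a • f)
    rwa [inv_smul_smul₀ ha.ne', ← div_eq_inv_mul, le_div_iff₀' ha] at this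
  have hadd : ∀ f g, p (f + g) ≤ p f + p g := by
    intro f g
    rw [← sub_le_iff_le_add]
    refine le_csInf (weightedCoverSums_nonempty s f) fun v hv => ?_
    rw [sub_le_comm]
    refine le_csInf (weightedCoverSums_nonempty s g) fun v' hv' => ?_
    rw [sub_le_iff_le_add']
    exact hple (add_mem_weightedCoverSums hv hv')
  have hpnonneg : ∀ f, 0 ≤ p f := fun f =>
    le_csInf (weightedCoverSums_nonempty s f) fun v hv => weightedCoverSums_nonneg hv
  have h1 : (1 : C(X, ℝ)) ≠ 0 := one_ne_zero
  obtain ⟨g, hg1, hgp⟩ := exists_extension_of_le_sublinear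
    (LinearPMap.mkSpanSingleton (σ := RingHom.id ℝ) (1 : C(X, ℝ)) (p 1) h1) p hsmul hadd (by
      rintro ⟨f, hf⟩
      obtain ⟨a, rfl⟩ := Submodule.mem_span_singleton.1 hf
      rw [LinearPMap.mkSpanSingleton'_apply]
      rcases lt_or_ge 0 a with ha | ha
      · exact (hsmul a ha 1).symm.le
      · exact (mul_nonpos_of_nonpos_of_nonneg ha hp1.le).trans (hpnonneg _))
  have hg1' : g 1 = p 1 := by
    have := hg1 ⟨1, Submodule.mem_span_singleton_self 1⟩
    rwa [LinearPMap.mkSpanSingleton_apply] at this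
  refine ⟨g, fun f hf => ?_, hg1' ▸ hp1, fun f x r hr hf => (hgp f).trans (hple ?_)⟩
  · have h2 := (hgp (-f)).trans (hple (v := 0) ⟨Empty, inferInstance, Empty.elim, Empty.elim,
      Empty.elim, fun i => i.elim, fun i => i.elim, fun z => by simpa using hf z, by simp⟩)
    rw [map_neg] at h2
    linarith
  · exact ⟨Unit, inferInstance, fun _ => x, fun _ => r, fun _ => 1, fun _ => hr,
      fun _ => zero_le_one, fun z => by simpa using hf z, by simp⟩

/-- **Frostman's lemma** on a compact metric space. -/
lemma exists_frostman_measure [CompactSpace X] [MeasurableSpace X] [BorelSpace X] {s : ℝ}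
    (hs : 0 < s) (h : Measure.hausdorffMeasure s (Set.univ : Set X) ≠ 0) :
    ∃ μ : Measure X, IsFiniteMeasure μ ∧ μ ≠ 0 ∧ ∀ x, ∀ r : ℝ, 0 < r →
      μ (Metric.closedBall x r) ≤ ENNReal.ofReal (2 ^ s) * ENNReal.ofReal (r ^ s) := by
  obtain ⟨g, hg0, hg1, hg⟩ := exists_positive_functional hs h
  let L : CompactlySupportedContinuousMap X ℝ →ₗ[ℝ] ℝ :=
    { toFun := fun f => g f.toContinuousMap
      map_add' := fun f f' => by rw [← map_add]; rfl
      map_smul' := fun a f => by rw [← map_smul]; rfl }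
  let Λ : CompactlySupportedContinuousMap X ℝ →ₚ[ℝ] ℝ :=
    PositiveLinearMap.mk₀ L fun f hf => hg0 _ fun z => hf z
  have hΛ : ∀ f : C(X, ℝ), Λ (CompactlySupportedContinuousMap.continuousMapEquiv f) = g f :=
    fun f => rfl
  refine ⟨RealRMK.rieszMeasure Λ, ⟨?_⟩, fun h0 => ?_, fun x r hr => ?_⟩
  · refine (RealRMK.rieszMeasure_le_of_eq_one Λ
      (f := CompactlySupportedContinuousMap.continuousMapEquiv 1) (fun _ => zero_le_one)
      isCompact_univ fun _ _ => rfl).trans_lt ENNReal.ofReal_lt_top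
  · have := RealRMK.integral_rieszMeasure Λ (CompactlySupportedContinuousMap.continuousMapEquiv 1)
    rw [h0, integral_zero_measure, hΛ] at this
    exact hg1.ne this
  · let f : C(X, ℝ) := ⟨fun y => max 0 (min 1 (2 - dist y x / r)), by fun_prop⟩
    have hf : ∀ y, f y = max 0 (min 1 (2 - dist y x / r)) := fun y => rfl
    rw [← ENNReal.ofReal_mul (by positivity), ← Real.mul_rpow (by norm_num) hr.le]
    refine (RealRMK.rieszMeasure_le_of_eq_one Λ
      (f := CompactlySupportedContinuousMap.continuousMapEquiv f) (fun y => le_max_left _ _)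
      (isCompact_closedBall x r) fun y hy => ?_).trans
      (ENNReal.ofReal_le_ofReal (hg f x (2 * r) (by positivity) fun y => ?_))
    · change f y = 1
      rw [hf]
      have : dist y x / r ≤ 1 := (div_le_one hr).2 hy
      rw [min_eq_left (by linarith), max_eq_right zero_le_one]
    · rw [hf]
      split_ifs with hy
      · exact max_le zero_le_one (min_le_left _ _)
      · refine max_le le_rfl ((min_le_right _ _).trans ?_)
        rw [sub_nonpos, le_div_iff₀ hr]
        exact (not_le.1 hy).le

end Frostman

section Gaussian

/-- The constant in the Gaussian integral bound for measures of dimension `s`. -/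
noncomputable def gaussianSum (s : ℝ) : ℝ≥0∞ :=
  ∑' k : ℕ, ENNReal.ofReal (Real.exp (-(k : ℝ) ^ 2) * ((k : ℝ) + 1) ^ s)

lemma gaussianSum_ne_top (s : ℝ) : gaussianSum s ≠ ∞ := by
  have h1 : Summable fun k : ℕ => ((k + 1 : ℕ) : ℝ) ^ ⌈s⌉₊ * Real.exp (-1 * ((k + 1 : ℕ) : ℝ)) :=
    (summable_nat_add_iff 1).2 (Real.summable_pow_mul_exp_neg_nat_mul ⌈s⌉₊ one_pos)
  have h2 : Summable fun k : ℕ => Real.exp (-(k : ℝ) ^ 2) * ((k : ℝ) + 1) ^ s := by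
    refine Summable.of_nonneg_of_le (fun k => by positivity) (fun k => ?_)
      (h1.mul_left (Real.exp 1))
    have hk : (k : ℝ) ≤ (k : ℝ) ^ 2 := by exact_mod_cast Nat.le_self_pow (by norm_num) k
    have e1 : Real.exp (-(k : ℝ) ^ 2) ≤ Real.exp 1 * Real.exp (-1 * ((k + 1 : ℕ) : ℝ)) := by
      rw [← Real.exp_add, Real.exp_le_exp]
      push_cast
      linarith
    have e2 : ((k : ℝ) + 1) ^ s ≤ ((k + 1 : ℕ) : ℝ) ^ ⌈s⌉₊ := by
      push_cast
      rw [← Real.rpow_natCast]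
      exact Real.rpow_le_rpow_of_exponent_le (by linarith [Nat.cast_nonneg (α := ℝ) k])
        (Nat.le_ceil s)
    calc _ ≤ (Real.exp 1 * Real.exp (-1 * ((k + 1 : ℕ) : ℝ))) * ((k + 1 : ℕ) : ℝ) ^ ⌈s⌉₊ := by
          gcongr
      _ = _ := by ring
  rw [gaussianSum, ← ENNReal.ofReal_tsum_of_nonneg (fun k => by positivity) h2]
  exact ENNReal.ofReal_ne_top

lemma lintegral_exp_neg_sq_le {X : Type*} [MeasurableSpace X] (μ : Measure X) {g : X → ℝ}
    (hg : Measurable g) (hg0 : ∀ x, 0 ≤ g x) {s : ℝ} {C : ℝ≥0∞}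
    (h : ∀ r > 0, μ {x | g x ≤ r} ≤ C * ENNReal.ofReal (r ^ s)) {R : ℝ} (hR : 0 < R) :
    ∫⁻ x, ENNReal.ofReal (Real.exp (-(R * g x) ^ 2)) ∂μ ≤
      gaussianSum s * C * ENNReal.ofReal (R ^ (-s)) := by
  have hS : ∀ r : ℝ, MeasurableSet {x | g x ≤ r} := fun r => measurableSet_le hg measurable_const
  calc ∫⁻ x, ENNReal.ofReal (Real.exp (-(R * g x) ^ 2)) ∂μ
      ≤ ∫⁻ x, ∑' k : ℕ, {x | g x ≤ (k + 1) / R}.indicator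
          (fun _ => ENNReal.ofReal (Real.exp (-(k : ℝ) ^ 2))) x ∂μ := by
        refine lintegral_mono fun x => ?_
        refine le_trans ?_ (ENNReal.le_tsum ⌊R * g x⌋₊)
        have h0 : 0 ≤ R * g x := mul_nonneg hR.le (hg0 x)
        rw [Set.indicator_of_mem]
        · gcongr
          exact Nat.floor_le h0
        · simp only [Set.mem_ofPred_eq]
          rw [le_div_iff₀ hR, mul_comm]
          exact (Nat.lt_floor_add_one _).le
    _ = ∑' k : ℕ, ENNReal.ofReal (Real.exp (-(k : ℝ) ^ 2)) * μ {x | g x ≤ (k + 1) / R} := by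
        rw [lintegral_tsum (fun k => (measurable_const.indicator (hS _)).aemeasurable)]
        refine tsum_congr fun k => ?_
        rw [lintegral_indicator_const (hS _)]
    _ ≤ ∑' k : ℕ, ENNReal.ofReal (Real.exp (-(k : ℝ) ^ 2) * ((k : ℝ) + 1) ^ s) *
          (C * ENNReal.ofReal (R ^ (-s))) := by
        refine ENNReal.tsum_le_tsum fun k => ?_
        calc _ ≤ ENNReal.ofReal (Real.exp (-(k : ℝ) ^ 2)) *
              (C * ENNReal.ofReal (((k + 1) / R) ^ s)) := by
              gcongr
              exact h _ (by positivity)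
          _ = _ := by
              rw [Real.div_rpow (by positivity) hR.le, div_eq_mul_inv, ← Real.rpow_neg hR.le,
                ENNReal.ofReal_mul (by positivity), ENNReal.ofReal_mul (by positivity)]
              ring
    _ = _ := by rw [ENNReal.tsum_mul_right, gaussianSum, mul_assoc]

lemma one_le_exp_mul_tsum_dyadic {t x : ℝ} (hx : 0 ≤ x) (hx1 : x ≤ 1) :
    1 ≤ ENNReal.ofReal (Real.exp 4) * ∑' j : ℕ,
      ENNReal.ofReal (((2 : ℝ) ^ j) ^ (-t)) * ENNReal.ofReal (Real.exp (-(x / 2 ^ j) ^ 2)) := by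
  refine le_trans ?_ (mul_le_mul_right (ENNReal.le_tsum 0) _)
  simp only [pow_zero, Real.one_rpow, ENNReal.ofReal_one, one_mul, div_one]
  rw [← ENNReal.ofReal_mul (by positivity), ← Real.exp_add, ENNReal.one_le_ofReal,
    Real.one_le_exp_iff]
  nlinarith

lemma rpow_neg_le_exp_mul_tsum_dyadic {t x : ℝ} (ht : 0 ≤ t) (hx : 1 ≤ x) :
    ENNReal.ofReal (x ^ (-t)) ≤ ENNReal.ofReal (Real.exp 4) * ∑' j : ℕ,
      ENNReal.ofReal (((2 : ℝ) ^ j) ^ (-t)) * ENNReal.ofReal (Real.exp (-(x / 2 ^ j) ^ 2)) := by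
  obtain ⟨j, hj1, hj2⟩ := exists_nat_pow_near hx (one_lt_two)
  refine le_trans ?_ (mul_le_mul_right (ENNReal.le_tsum j) _)
  rw [← ENNReal.ofReal_mul (by positivity), ← ENNReal.ofReal_mul (by positivity)]
  refine ENNReal.ofReal_le_ofReal ?_
  have h1 : x ^ (-t) ≤ ((2 : ℝ) ^ j) ^ (-t) :=
    Real.rpow_le_rpow_of_nonpos (by positivity) hj1 (by linarith)
  have h2 : x / 2 ^ j ≤ 2 := by
    rw [div_le_iff₀ (by positivity)]
    rw [pow_succ] at hj2
    linarith
  have h3 : 0 ≤ x / 2 ^ j := by positivity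
  have h4 : 1 ≤ Real.exp 4 * Real.exp (-(x / 2 ^ j) ^ 2) := by
    rw [← Real.exp_add, Real.one_le_exp_iff]
    nlinarith
  have h5 : 0 ≤ ((2 : ℝ) ^ j) ^ (-t) := by positivity
  calc x ^ (-t) ≤ ((2 : ℝ) ^ j) ^ (-t) * 1 := by linarith
    _ ≤ ((2 : ℝ) ^ j) ^ (-t) * (Real.exp 4 * Real.exp (-(x / 2 ^ j) ^ 2)) := by gcongr
    _ = _ := by ring

end Gaussian

section Kernel

variable {V : Type*} [NormedAddCommGroup V] [InnerProductSpace ℝ V]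

lemma exp_neg_sq_norm_sub_smul_le {m : ℝ} (hm : 1 ≤ m) {e₁ e₂ p : V} (h₁ : ‖e₁‖ ≤ m)
    (h₂ : ‖e₂‖ ≤ m) (hp : ‖p‖ ≤ m) (hp₁ : inner ℝ e₁ p = 1) (hp₂ : |inner ℝ e₂ p| ≤ m)
    (η : V) (r g : ℝ) (hg0 : 0 ≤ g)
    (hg : g ≤ max |inner ℝ e₂ η - inner ℝ e₁ η * inner ℝ e₂ p| (‖η‖ - m * |inner ℝ e₁ η|)) :
    Real.exp (-(1 / 2) * ‖η - r • p‖ ^ 2) ≤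
      Real.exp (-(1 / (4 * m ^ 2)) * (inner ℝ e₁ η - r) ^ 2) *
        Real.exp (-(1 / (4 * m ^ 2) * g) ^ 2) := by
  set D := ‖η - r • p‖
  set a := inner ℝ e₁ η with ha
  set c := inner ℝ e₂ η with hc
  set h := inner ℝ e₂ p with hh
  have hD : 0 ≤ D := norm_nonneg _
  have i1 : |a - r| ≤ m * D := by
    have : a - r = inner ℝ e₁ (η - r • p) := by
      rw [inner_sub_right, inner_smul_right, hp₁, mul_one]
    rw [this]
    exact (abs_real_inner_le_norm _ _).trans (by gcongr)
  have i2 : |c - r * h| ≤ m * D := by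
    have : c - r * h = inner ℝ e₂ (η - r • p) := by rw [inner_sub_right, inner_smul_right]
    rw [this]
    exact (abs_real_inner_le_norm _ _).trans (by gcongr)
  have i3 : |c - a * h| ≤ 2 * m ^ 2 * D := by
    calc |c - a * h| = |(c - r * h) + (r - a) * h| := by ring_nf
      _ ≤ |c - r * h| + |r - a| * |h| := by rw [← abs_mul]; exact abs_add_le _ _
      _ ≤ m * D + m * D * m := by
          rw [abs_sub_comm r a]
          gcongr
      _ ≤ _ := by
        nlinarith [mul_nonneg (mul_nonneg (by linarith : 0 ≤ m) hD) (by linarith : 0 ≤ m - 1)]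
  have i4 : ‖η‖ - m * |a| ≤ 2 * m ^ 2 * D := by
    have k1 : ‖η‖ ≤ D + |r| * m := by
      calc ‖η‖ = ‖(η - r • p) + r • p‖ := by simp
        _ ≤ D + ‖r • p‖ := norm_add_le _ _
        _ ≤ _ := by rw [norm_smul, Real.norm_eq_abs]; gcongr
    have k2 : |r| ≤ |a| + m * D := by
      have := abs_sub_abs_le_abs_sub r a
      rw [abs_sub_comm r a] at this
      linarith
    have k3 : |r| * m ≤ (|a| + m * D) * m := by gcongr
    nlinarith [mul_nonneg hD (by nlinarith : 0 ≤ m ^ 2 - 1)]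
  have i5 : g ≤ 2 * m ^ 2 * D := hg.trans (max_le i3 i4)
  have hm2 : 0 < m ^ 2 := by positivity
  have j1 : 1 / (4 * m ^ 2) * (a - r) ^ 2 ≤ 1 / 4 * D ^ 2 := by
    have : (a - r) ^ 2 ≤ (m * D) ^ 2 := by
      rw [← sq_abs (a - r)]; gcongr
    calc _ ≤ 1 / (4 * m ^ 2) * (m * D) ^ 2 := by gcongr
      _ = _ := by field_simp
  have j2 : (1 / (4 * m ^ 2) * g) ^ 2 ≤ 1 / 4 * D ^ 2 := by
    calc _ ≤ (1 / (4 * m ^ 2) * (2 * m ^ 2 * D)) ^ 2 := by gcongr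
      _ = _ := by field_simp; norm_num
  rw [← Real.exp_add, Real.exp_le_exp]
  linarith

/-- Decay of the Gaussian regularisation of the measure `dr × ν` on the cone over a curve `ψ`. -/
lemma lintegral_cone_le [MeasurableSpace V] [BorelSpace V] [SecondCountableTopology V]
    {Y : Type*} [MeasurableSpace Y] (ν : Measure Y) [IsFiniteMeasure ν]
    {ψ : Y → V} (hψ : Measurable ψ) {m : ℝ} (hm : 1 ≤ m) {e₁ e₂ : V} (h₁ : ‖e₁‖ ≤ m)
    (h₂ : ‖e₂‖ ≤ m) (hp : ∀ y, ‖ψ y‖ ≤ m) (hp₁ : ∀ y, inner ℝ e₁ (ψ y) = 1)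
    (hp₂ : ∀ y, |inner ℝ e₂ (ψ y)| ≤ m) {t : ℝ} (ht : 0 ≤ t) {C : ℝ≥0∞} (hC : C ≠ ∞)
    (hν : ∀ a, ∀ r > 0, ν {y | |inner ℝ e₂ (ψ y) - a| ≤ r} ≤ C * ENNReal.ofReal (r ^ t)) :
    ∃ K : ℝ≥0∞, K ≠ ∞ ∧ ∀ η : V,
      ∫⁻ y, (∫⁻ r : ℝ, ENNReal.ofReal (Real.exp (-(1 / 2) * ‖η - r • ψ y‖ ^ 2))) ∂ν ≤
        K * ∑' j : ℕ, ENNReal.ofReal (((2 : ℝ) ^ j) ^ (-t)) *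
          ENNReal.ofReal (Real.exp (-(‖η‖ / 2 ^ j) ^ 2)) := by
  have hm0 : 0 < m := by linarith
  set G : ℝ≥0∞ := ∫⁻ r : ℝ, ENNReal.ofReal (Real.exp (-(1 / (4 * m ^ 2)) * r ^ 2)) with hG
  have hGtop : G ≠ ∞ := (integrable_exp_neg_mul_sq (by positivity)).lintegral_lt_top.ne
  have base : ∀ (η : V) (g : Y → ℝ), (∀ y, 0 ≤ g y) → (∀ y, g y ≤
      max |inner ℝ e₂ η - inner ℝ e₁ η * inner ℝ e₂ (ψ y)| (‖η‖ - m * |inner ℝ e₁ η|)) →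
      ∫⁻ y, (∫⁻ r : ℝ, ENNReal.ofReal (Real.exp (-(1 / 2) * ‖η - r • ψ y‖ ^ 2))) ∂ν ≤
        G * ∫⁻ y, ENNReal.ofReal (Real.exp (-(1 / (4 * m ^ 2) * g y) ^ 2)) ∂ν := by
    intro η g hg0 hg
    rw [← lintegral_const_mul' _ _ hGtop]
    refine lintegral_mono fun y => ?_
    calc _ ≤ ∫⁻ r : ℝ, ENNReal.ofReal (Real.exp (-(1 / (4 * m ^ 2)) * (inner ℝ e₁ η - r) ^ 2)) *
          ENNReal.ofReal (Real.exp (-(1 / (4 * m ^ 2) * g y) ^ 2)) := by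
          refine lintegral_mono fun r => ?_
          rw [← ENNReal.ofReal_mul (by positivity)]
          exact ENNReal.ofReal_le_ofReal (exp_neg_sq_norm_sub_smul_le hm h₁ h₂ (hp y) (hp₁ y)
            (hp₂ y) η r (g y) (hg0 y) (hg y))
      _ = _ := by
          rw [lintegral_mul_const' _ _ ENNReal.ofReal_ne_top, hG]
          congr 1
          exact lintegral_sub_left_eq_self (μ := volume)
            (fun r : ℝ => ENNReal.ofReal (Real.exp (-(1 / (4 * m ^ 2)) * r ^ 2))) (inner ℝ e₁ η)
  set C₁ : ℝ≥0∞ := (C + ν Set.univ) * ENNReal.ofReal ((2 * m) ^ t) with hC₁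
  have hC₁top : C₁ ≠ ∞ := by
    refine ENNReal.mul_ne_top (ENNReal.add_ne_top.2 ⟨hC, measure_ne_top _ _⟩) ENNReal.ofReal_ne_top
  set K₁ : ℝ≥0∞ := G * (gaussianSum t * C₁ * ENNReal.ofReal ((1 / (4 * m ^ 2)) ^ (-t))) with hK₁
  have hK₁top : K₁ ≠ ∞ := ENNReal.mul_ne_top hGtop
    (ENNReal.mul_ne_top (ENNReal.mul_ne_top (gaussianSum_ne_top t) hC₁top) ENNReal.ofReal_ne_top)
  have large : ∀ η : V, 0 < ‖η‖ →
      ∫⁻ y, (∫⁻ r : ℝ, ENNReal.ofReal (Real.exp (-(1 / 2) * ‖η - r • ψ y‖ ^ 2))) ∂ν ≤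
        K₁ * ENNReal.ofReal (‖η‖ ^ (-t)) := by
    intro η hη
    have hsplit : ∀ ρ > 0, C₁ * ENNReal.ofReal (‖η‖ ^ (-t)) * ENNReal.ofReal (ρ ^ t) =
        (C + ν Set.univ) * ENNReal.ofReal ((2 * m * ρ / ‖η‖) ^ t) := by
      intro ρ hρ
      rw [Real.div_rpow (by positivity) hη.le, Real.mul_rpow (by positivity) hρ.le,
        div_eq_mul_inv, ← Real.rpow_neg hη.le, ENNReal.ofReal_mul (by positivity),
        ENNReal.ofReal_mul (by positivity), hC₁]
      ring
    have fin : ∀ g : Y → ℝ, Measurable g → (∀ y, 0 ≤ g y) → (∀ y, g y ≤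
        max |inner ℝ e₂ η - inner ℝ e₁ η * inner ℝ e₂ (ψ y)| (‖η‖ - m * |inner ℝ e₁ η|)) →
        (∀ ρ > 0, ν {y | g y ≤ ρ} ≤ (C + ν Set.univ) * ENNReal.ofReal ((2 * m * ρ / ‖η‖) ^ t)) →
        ∫⁻ y, (∫⁻ r : ℝ, ENNReal.ofReal (Real.exp (-(1 / 2) * ‖η - r • ψ y‖ ^ 2))) ∂ν ≤
        K₁ * ENNReal.ofReal (‖η‖ ^ (-t)) := by
      intro g hgm hg0 hg hgν
      refine (base η g hg0 hg).trans ?_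
      have := lintegral_exp_neg_sq_le ν hgm hg0 (s := t) (C := C₁ * ENNReal.ofReal (‖η‖ ^ (-t)))
        (fun ρ hρ => (hgν ρ hρ).trans (hsplit ρ hρ).ge) (R := 1 / (4 * m ^ 2)) (by positivity)
      refine (mul_le_mul_right this G).trans (le_of_eq ?_)
      rw [hK₁]
      ring
    by_cases hcase : ‖η‖ / (2 * m) ≤ |inner ℝ e₁ η|
    · refine fin (fun y => |inner ℝ e₂ η - inner ℝ e₁ η * inner ℝ e₂ (ψ y)|) (by fun_prop)
        (fun y => abs_nonneg _) (fun y => le_max_left _ _) fun ρ hρ => ?_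
      have ha : 0 < |inner ℝ e₁ η| := lt_of_lt_of_le (by positivity) hcase
      have hsub : {y | |inner ℝ e₂ η - inner ℝ e₁ η * inner ℝ e₂ (ψ y)| ≤ ρ} ⊆
          {y | |inner ℝ e₂ (ψ y) - inner ℝ e₂ η / inner ℝ e₁ η| ≤ ρ / |inner ℝ e₁ η|} := by
        intro y hy
        simp only [Set.mem_ofPred_eq] at hy ⊢
        rw [le_div_iff₀ ha, ← abs_mul, sub_mul, div_mul_cancel₀ _ (abs_pos.1 ha), abs_sub_comm,
          mul_comm (inner ℝ e₂ (ψ y))]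
        exact hy
      calc _ ≤ _ := measure_mono hsub
        _ ≤ C * ENNReal.ofReal ((ρ / |inner ℝ e₁ η|) ^ t) := hν _ _ (by positivity)
        _ ≤ _ := by
            refine mul_le_mul' le_self_add
              (ENNReal.ofReal_le_ofReal (Real.rpow_le_rpow (by positivity) ?_ ht))
            rw [div_le_div_iff₀ ha hη]
            rw [div_le_iff₀ (by positivity)] at hcase
            nlinarith
    · push Not at hcase
      refine fin (fun _ => ‖η‖ / 2) (by fun_prop) (fun y => by positivity) (fun y => ?_)
        fun ρ hρ => ?_
      · refine le_max_of_le_right ?_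
        rw [lt_div_iff₀ (by positivity)] at hcase
        nlinarith
      · by_cases hρ2 : ‖η‖ / 2 ≤ ρ
        · calc _ ≤ ν Set.univ * 1 := by rw [mul_one]; exact measure_mono (Set.subset_univ _)
            _ ≤ _ := by
              gcongr
              · exact le_add_self
              · rw [ENNReal.one_le_ofReal]
                refine Real.one_le_rpow ?_ ht
                rw [le_div_iff₀ hη]
                nlinarith
        · simp [hρ2]
  set K₀ : ℝ≥0∞ := G * ν Set.univ with hK₀
  have small : ∀ η : V,
      ∫⁻ y, (∫⁻ r : ℝ, ENNReal.ofReal (Real.exp (-(1 / 2) * ‖η - r • ψ y‖ ^ 2))) ∂ν ≤ K₀ := by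
    intro η
    refine (base η (fun _ => 0) (fun _ => le_rfl)
      (fun y => le_max_of_le_left (abs_nonneg _))).trans ?_
    simp [hK₀]
  refine ⟨(K₀ + K₁) * ENNReal.ofReal (Real.exp 4), ENNReal.mul_ne_top (ENNReal.add_ne_top.2
    ⟨ENNReal.mul_ne_top hGtop (measure_ne_top _ _), hK₁top⟩) ENNReal.ofReal_ne_top, fun η => ?_⟩
  rw [mul_assoc]
  rcases le_total ‖η‖ 1 with h | h
  · calc _ ≤ K₀ * 1 := by rw [mul_one]; exact small η
      _ ≤ _ := mul_le_mul' le_self_add (one_le_exp_mul_tsum_dyadic (norm_nonneg _) h)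
  · exact (large η (by linarith)).trans
      (mul_le_mul' le_add_self (rpow_neg_le_exp_mul_tsum_dyadic ht h))

end Kernel

section Fourier

variable {V : Type*} [NormedAddCommGroup V] [InnerProductSpace ℝ V] [FiniteDimensional ℝ V]
  [MeasurableSpace V] [BorelSpace V]

lemma integrable_exp_neg_mul_sq_norm {b : ℝ} (hb : 0 < b) :
    Integrable (fun v : V => Real.exp (-b * ‖v‖ ^ 2)) := by
  have h := (GaussianFourier.integrable_cexp_neg_mul_sq_norm_add (V := V) (b := (b : ℂ))
    (by simpa using hb) 0 0).norm
  refine h.congr (Filter.Eventually.of_forall fun v => ?_)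
  simp only [Complex.norm_exp]
  congr 1
  simp [← Complex.ofReal_pow]

/-- Averaging a characteristic function against a translated Gaussian. -/
lemma integral_charFun_mul_exp (μ : Measure V) [IsFiniteMeasure μ] {b : ℝ} (hb : 0 < b) (ξ : V) :
    ∫ v : V, charFun μ (ξ + v) * (Real.exp (-b * ‖v‖ ^ 2) : ℂ) =
      (((Real.pi / b) ^ (Module.finrank ℝ V / 2 : ℝ) : ℝ) : ℂ) *
        ∫ x, Complex.exp (inner ℝ x ξ * Complex.I) *
          (Real.exp (-(1 / (4 * b)) * ‖x‖ ^ 2) : ℂ) ∂μ := by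
  have hprod : Integrable (Function.uncurry fun (v x : V) =>
      Complex.exp (inner ℝ x (ξ + v) * Complex.I) * (Real.exp (-b * ‖v‖ ^ 2) : ℂ))
      (volume.prod μ) := by
    refine Integrable.mono (g := fun p : V × V => Real.exp (-b * ‖p.1‖ ^ 2) * 1)
      ((integrable_exp_neg_mul_sq_norm hb).mul_prod (integrable_const (1 : ℝ))) ?_ ?_
    · exact Continuous.aestronglyMeasurable (by unfold Function.uncurry; fun_prop)
    · refine Filter.Eventually.of_forall fun p => ?_
      simp only [Function.uncurry, norm_mul, Complex.norm_exp_ofReal_mul_I, one_mul,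
        Complex.norm_real, mul_one, le_refl]
  calc _ = ∫ v : V, ∫ x, Complex.exp (inner ℝ x (ξ + v) * Complex.I) *
        (Real.exp (-b * ‖v‖ ^ 2) : ℂ) ∂μ := by
        simp_rw [charFun_apply, integral_mul_const]
    _ = ∫ x, (∫ v : V, Complex.exp (inner ℝ x (ξ + v) * Complex.I) *
        (Real.exp (-b * ‖v‖ ^ 2) : ℂ)) ∂μ := integral_integral_swap hprod
    _ = _ := by
        rw [← integral_const_mul]
        congr 1 with x
        have key := GaussianFourier.integral_cexp_neg_mul_sq_norm_add (V := V) (b := (b : ℂ))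
          (by simpa using hb) Complex.I x
        have e : ∀ v : V, Complex.exp (inner ℝ x (ξ + v) * Complex.I) *
            (Real.exp (-b * ‖v‖ ^ 2) : ℂ) = Complex.exp (inner ℝ x ξ * Complex.I) *
            Complex.exp (-b * ‖v‖ ^ 2 + Complex.I * inner ℝ x v) := by
          intro v
          rw [Complex.ofReal_exp, ← Complex.exp_add, ← Complex.exp_add, inner_add_right]
          push_cast
          ring_nf
        simp_rw [e]
        rw [integral_const_mul, key]
        rw [Complex.ofReal_cpow (by positivity), Complex.ofReal_exp]
        push_cast
        rw [Complex.I_sq]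
        ring_nf

lemma lintegral_enorm_charFun_sq_mul_exp (μ : Measure V) [IsFiniteMeasure μ] {b : ℝ} (hb : 0 < b) :
    ∫⁻ ξ : V, ‖charFun μ ξ‖ₑ ^ 2 * ENNReal.ofReal (Real.exp (-b * ‖ξ‖ ^ 2)) =
      ENNReal.ofReal ((Real.pi / b) ^ (Module.finrank ℝ V / 2 : ℝ)) *
        ∫⁻ x, ∫⁻ x', ENNReal.ofReal (Real.exp (-(1 / (4 * b)) * ‖x - x'‖ ^ 2)) ∂μ ∂μ := by
  have hneg : Measurable (fun x : V => -x) := measurable_neg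
  set κ : Measure V := μ ∗ μ.map (fun x => -x) with hκ
  have hchar : ∀ ξ : V, charFun κ ξ = ((‖charFun μ ξ‖ ^ 2 : ℝ) : ℂ) := by
    intro ξ
    rw [hκ, charFun_conv]
    have : charFun (μ.map (fun x => -x)) ξ = charFun μ (-ξ) := by
      rw [charFun_apply, integral_map hneg.aemeasurable
        (Continuous.aestronglyMeasurable (by fun_prop)), charFun_apply]
      simp
    rw [this, charFun_neg, Complex.mul_conj, Complex.normSq_eq_norm_sq]
  have key := integral_charFun_mul_exp κ hb (0 : V)
  simp only [zero_add, hchar, inner_zero_right, Complex.ofReal_zero, zero_mul, Complex.exp_zero,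
    one_mul] at key
  simp_rw [← Complex.ofReal_mul] at key
  rw [integral_complex_ofReal, integral_complex_ofReal, ← Complex.ofReal_mul,
    Complex.ofReal_inj] at key
  have hg : Integrable (fun ξ : V => ‖charFun μ ξ‖ ^ 2 * Real.exp (-b * ‖ξ‖ ^ 2)) := by
    refine Integrable.mono ((integrable_exp_neg_mul_sq_norm hb).const_mul
      ((μ.real Set.univ) ^ 2)) ?_ (Filter.Eventually.of_forall fun ξ => ?_)
    · exact (((stronglyMeasurable_charFun.norm.pow 2).mul
        (Continuous.stronglyMeasurable (by fun_prop)))).aestronglyMeasurable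
    · rw [Real.norm_of_nonneg (by positivity), Real.norm_of_nonneg (by positivity)]
      gcongr
      exact norm_charFun_le ξ
  have hr : Integrable (fun x : V => Real.exp (-(1 / (4 * b)) * ‖x‖ ^ 2)) κ := by
    refine Integrable.mono (integrable_const (1 : ℝ))
      (Continuous.aestronglyMeasurable (by fun_prop)) (Filter.Eventually.of_forall fun ξ => ?_)
    rw [Real.norm_of_nonneg (by positivity), norm_one, Real.exp_le_one_iff]
    have : 0 ≤ 1 / (4 * b) * ‖ξ‖ ^ 2 := by positivity
    linarith
  have key2 := congrArg ENNReal.ofReal key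
  rw [ENNReal.ofReal_mul (by positivity), ofReal_integral_eq_lintegral_ofReal hg
    (Filter.Eventually.of_forall fun _ => by positivity), ofReal_integral_eq_lintegral_ofReal hr
    (Filter.Eventually.of_forall fun _ => by positivity)] at key2
  have hm : Measurable fun x : V => ENNReal.ofReal (Real.exp (-(1 / (4 * b)) * ‖x‖ ^ 2)) := by
    fun_prop
  rw [hκ, Measure.lintegral_conv hm] at key2
  convert key2 using 2
  · ext ξ
    rw [ENNReal.ofReal_mul (by positivity), ENNReal.ofReal_pow (by positivity), ofReal_norm]
  · refine lintegral_congr fun x => ?_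
    rw [lintegral_map (by fun_prop) hneg]
    simp [sub_eq_add_neg]

/-- Pointwise form of the uncertainty principle: after multiplication of `μ` by a Gaussian, the
square of the characteristic function is controlled by its averages at unit scale. -/
lemma enorm_charFun_withDensity_sq_le (μ : Measure V) [IsFiniteMeasure μ] (ξ : V) :
    ‖charFun (μ.withDensity fun x => ENNReal.ofReal (Real.exp (-(1 / 2) * ‖x‖ ^ 2))) ξ‖ₑ ^ 2 ≤
      (∫⁻ v : V, ENNReal.ofReal (Real.exp (-(1 / 2) * ‖v‖ ^ 2))) *
        ∫⁻ v : V, ‖charFun μ v‖ₑ ^ 2 * ENNReal.ofReal (Real.exp (-(1 / 2) * ‖v - ξ‖ ^ 2)) := by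
  have key := integral_charFun_mul_exp μ (b := 1 / 2) (by norm_num) ξ
  have e1 : charFun (μ.withDensity fun x => ENNReal.ofReal (Real.exp (-(1 / 2) * ‖x‖ ^ 2))) ξ =
      ∫ x, Complex.exp (inner ℝ x ξ * Complex.I) * (Real.exp (-(1 / 2) * ‖x‖ ^ 2) : ℂ) ∂μ := by
    rw [charFun_apply, integral_withDensity_eq_integral_toReal_smul (by fun_prop) (by simp)]
    congr 1 with x
    rw [ENNReal.toReal_ofReal (by positivity), Complex.real_smul, mul_comm]
  have e2 : -(1 / (4 * (1 / 2 : ℝ))) = -(1 / 2) := by norm_num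
  rw [e2, ← e1] at key
  set F := charFun (μ.withDensity fun x => ENNReal.ofReal (Real.exp (-(1 / 2) * ‖x‖ ^ 2))) ξ
  have hpi : (1 : ℝ) ≤ (Real.pi / (1 / 2)) ^ (Module.finrank ℝ V / 2 : ℝ) :=
    Real.one_le_rpow (by linarith [Real.pi_gt_three]) (by positivity)
  have h1 : ‖F‖ₑ ≤
      ∫⁻ v : V, ‖charFun μ (ξ + v)‖ₑ * ENNReal.ofReal (Real.exp (-(1 / 2) * ‖v‖ ^ 2)) := by
    calc ‖F‖ₑ ≤ ‖(((Real.pi / (1 / 2)) ^ (Module.finrank ℝ V / 2 : ℝ) : ℝ) : ℂ) * F‖ₑ := by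
          rw [enorm_mul]
          refine le_mul_of_one_le_left' ?_
          rw [← ofReal_norm, Complex.norm_real, Real.norm_of_nonneg (by linarith)]
          exact ENNReal.one_le_ofReal.mpr hpi
      _ = _ := by rw [← key]
      _ ≤ _ := enorm_integral_le_lintegral_enorm _
      _ = _ := by
          refine lintegral_congr fun v => ?_
          rw [enorm_mul, ← ofReal_norm (Complex.ofReal _), Complex.norm_real,
            Real.norm_of_nonneg (by positivity)]
  have hm : Measurable (charFun μ) := measurable_charFun
  have h2 := ENNReal.lintegral_mul_le_Lp_mul_Lq (volume : Measure V) Real.HolderConjugate.two_two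
    (f := fun v => ENNReal.ofReal (Real.exp (-(1 / 4) * ‖v‖ ^ 2)))
    (g := fun v => ‖charFun μ (ξ + v)‖ₑ * ENNReal.ofReal (Real.exp (-(1 / 4) * ‖v‖ ^ 2)))
    (by fun_prop) (by fun_prop)
  have e3 : ∀ v : V, ENNReal.ofReal (Real.exp (-(1 / 4) * ‖v‖ ^ 2)) *
      ENNReal.ofReal (Real.exp (-(1 / 4) * ‖v‖ ^ 2)) =
      ENNReal.ofReal (Real.exp (-(1 / 2) * ‖v‖ ^ 2)) := by
    intro v
    rw [← ENNReal.ofReal_mul (by positivity), ← Real.exp_add]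
    ring_nf
  have h3 : ∫⁻ v : V, ‖charFun μ (ξ + v)‖ₑ * ENNReal.ofReal (Real.exp (-(1 / 2) * ‖v‖ ^ 2)) ≤
      (∫⁻ v : V, ENNReal.ofReal (Real.exp (-(1 / 2) * ‖v‖ ^ 2))) ^ (1 / 2 : ℝ) *
      (∫⁻ v : V, ‖charFun μ (ξ + v)‖ₑ ^ 2 *
        ENNReal.ofReal (Real.exp (-(1 / 2) * ‖v‖ ^ 2))) ^ (1 / 2 : ℝ) := by
    convert h2 using 3
    · rw [Pi.mul_apply, mul_left_comm, e3]
    · congr 1 with v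
      rw [ENNReal.rpow_two, sq (ENNReal.ofReal _), e3]
    · congr 1 with v
      rw [ENNReal.rpow_two, mul_pow, sq (ENNReal.ofReal _), e3]
  calc ‖F‖ₑ ^ 2 ≤ ((∫⁻ v : V, ENNReal.ofReal (Real.exp (-(1 / 2) * ‖v‖ ^ 2))) ^ (1 / 2 : ℝ) *
      (∫⁻ v : V, ‖charFun μ (ξ + v)‖ₑ ^ 2 *
        ENNReal.ofReal (Real.exp (-(1 / 2) * ‖v‖ ^ 2))) ^ (1 / 2 : ℝ)) ^ 2 := by
        gcongr
        exact h1.trans h3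
    _ = (∫⁻ v : V, ENNReal.ofReal (Real.exp (-(1 / 2) * ‖v‖ ^ 2))) *
      (∫⁻ v : V, ‖charFun μ (ξ + v)‖ₑ ^ 2 *
        ENNReal.ofReal (Real.exp (-(1 / 2) * ‖v‖ ^ 2))) := by
        rw [mul_pow, ← ENNReal.rpow_mul_natCast, ← ENNReal.rpow_mul_natCast]
        norm_num
    _ = _ := by
        congr 1
        rw [← lintegral_add_left_eq_self (μ := volume) (fun v : V => ‖charFun μ v‖ₑ ^ 2 *
          ENNReal.ofReal (Real.exp (-(1 / 2) * ‖v - ξ‖ ^ 2))) ξ]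
        simp

end Fourier

section EnergyOnLine

lemma sq_lintegral_le_measure_mul_lintegral_sq {X : Type*} [MeasurableSpace X] (μ : Measure X)
    {f : X → ℝ≥0∞} (hf : Measurable f) {T : Set X} (hT : MeasurableSet T)
    (h : ∀ x, x ∉ T → f x = 0) : (∫⁻ x, f x ∂μ) ^ 2 ≤ μ T * ∫⁻ x, f x ^ 2 ∂μ := by
  have key := ENNReal.lintegral_mul_le_Lp_mul_Lq μ Real.HolderConjugate.two_two
    (f := T.indicator 1) (g := f) (measurable_one.indicator hT).aemeasurable hf.aemeasurable
  have e1 : ∀ x, (T.indicator (1 : X → ℝ≥0∞) * f) x = f x := by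
    intro x
    by_cases hx : x ∈ T <;> simp [hx, h]
  have e2 : ∀ x, T.indicator (1 : X → ℝ≥0∞) x ^ (2 : ℝ) = T.indicator 1 x := by
    intro x
    by_cases hx : x ∈ T <;> simp [hx]
  simp_rw [e1, e2, lintegral_indicator_one hT, ENNReal.rpow_two] at key
  calc (∫⁻ x, f x ∂μ) ^ 2
      ≤ (μ T ^ (1 / 2 : ℝ) * (∫⁻ x, f x ^ 2 ∂μ) ^ (1 / 2 : ℝ)) ^ 2 := by gcongr
    _ = _ := by
        rw [mul_pow, ← ENNReal.rpow_mul_natCast, ← ENNReal.rpow_mul_natCast]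
        norm_num

lemma lintegral_exp_neg_sq_dist_div_le (μ : Measure ℝ) [IsFiniteMeasure μ] {ε : ℝ} (hε : 0 < ε) :
    ∫⁻ u, ∫⁻ u', ENNReal.ofReal (Real.exp (-(|u - u'| / ε) ^ 2)) ∂μ ∂μ ≤
      ENNReal.ofReal ε * ∫⁻ ξ : ℝ, ‖charFun μ ξ‖ₑ ^ 2 := by
  have key := lintegral_enorm_charFun_sq_mul_exp μ (b := ε ^ 2 / 4) (by positivity)
  have e1 : ∀ u u' : ℝ, -(1 / (4 * (ε ^ 2 / 4))) * ‖u - u'‖ ^ 2 = -(|u - u'| / ε) ^ 2 := by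
    intro u u'
    rw [Real.norm_eq_abs]
    field_simp
  simp_rw [e1] at key
  set J := ∫⁻ u, ∫⁻ u', ENNReal.ofReal (Real.exp (-(|u - u'| / ε) ^ 2)) ∂μ ∂μ
  have h1 : ENNReal.ofReal ((Real.pi / (ε ^ 2 / 4)) ^ (Module.finrank ℝ ℝ / 2 : ℝ)) * J ≤
      ∫⁻ ξ : ℝ, ‖charFun μ ξ‖ₑ ^ 2 := by
    rw [← key]
    refine lintegral_mono fun ξ => mul_le_of_le_one_right' ?_
    rw [ENNReal.ofReal_le_one, Real.exp_le_one_iff]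
    nlinarith [sq_nonneg (ε * ‖ξ‖)]
  have h2 : ε⁻¹ ≤ (Real.pi / (ε ^ 2 / 4)) ^ (Module.finrank ℝ ℝ / 2 : ℝ) := by
    rw [Module.finrank_self, Nat.cast_one, ← Real.sqrt_eq_rpow]
    refine Real.le_sqrt_of_sq_le ?_
    rw [inv_pow, le_div_iff₀ (by positivity)]
    field_simp
    linarith [Real.pi_gt_three]
  calc J = ENNReal.ofReal ε * (ENNReal.ofReal ε⁻¹ * J) := by
        rw [← mul_assoc, ← ENNReal.ofReal_mul hε.le, mul_inv_cancel₀ hε.ne', ENNReal.ofReal_one,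
          one_mul]
    _ ≤ ENNReal.ofReal ε *
        (ENNReal.ofReal ((Real.pi / (ε ^ 2 / 4)) ^ (Module.finrank ℝ ℝ / 2 : ℝ)) * J) := by
        gcongr
    _ ≤ _ := by gcongr

lemma sq_measure_univ_le_measure_cthickening (μ : Measure ℝ) [IsFiniteMeasure μ] {K : Set ℝ}
    (hK : μ Kᶜ = 0) {ε : ℝ} (hε : 0 < ε) :
    μ Set.univ ^ 2 ≤ ENNReal.ofReal (Real.exp 4) * (∫⁻ ξ : ℝ, ‖charFun μ ξ‖ₑ ^ 2) *
      volume (Metric.cthickening ε K) := by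
  set Q := ∫⁻ ξ : ℝ, ‖charFun μ ξ‖ₑ ^ 2
  set S : Set (ℝ × ℝ) := {p | |p.1 - p.2| ≤ ε} with hS
  have hSm : MeasurableSet S := measurableSet_le (by fun_prop) (by fun_prop)
  set k : ℝ → ℝ → ℝ≥0∞ := fun u v => S.indicator 1 (u, v) with hk
  have hkm : Measurable (Function.uncurry k) := measurable_one.indicator hSm
  have hkm1 : ∀ u, Measurable (k u) := fun u => hkm.comp measurable_prodMk_left
  have hkm2 : ∀ v, Measurable fun u => k u v := fun v => hkm.comp measurable_prodMk_right
  have hkv : ∀ u, ∫⁻ v, k u v = ENNReal.ofReal (2 * ε) := by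
    intro u
    have : k u = (Metric.closedBall u ε).indicator 1 := by
      ext v
      have h : (u, v) ∈ S ↔ v ∈ Metric.closedBall u ε := by
        rw [Metric.mem_closedBall, Real.dist_eq, abs_sub_comm]
        rfl
      by_cases hv : v ∈ Metric.closedBall u ε
      · simp [hk, h.2 hv, hv]
      · simp [hk, mt h.1 hv, hv]
    rw [this, lintegral_indicator_one Metric.isClosed_closedBall.measurableSet,
      Real.volume_closedBall]
  set F : ℝ → ℝ≥0∞ := fun v => ∫⁻ u, k u v ∂μ with hF
  have hFm : Measurable F := hkm.lintegral_prod_left'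
  have hF0 : ∀ v, v ∉ Metric.cthickening ε K → F v = 0 := by
    intro v hv
    have hae : ∀ᵐ u ∂μ, k u v = 0 := by
      filter_upwards [show ∀ᵐ u ∂μ, u ∈ K from hK] with u hu
      refine Set.indicator_of_notMem (fun h => hv ?_) _
      refine Metric.mem_cthickening_of_dist_le v u ε K hu ?_
      rw [Real.dist_eq, abs_sub_comm]
      exact h
    rw [hF]
    simp only
    rw [lintegral_congr_ae hae, lintegral_zero]
  have hFint : ∫⁻ v, F v = ENNReal.ofReal (2 * ε) * μ Set.univ := by
    calc ∫⁻ v, F v = ∫⁻ u, (∫⁻ v, k u v) ∂μ :=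
          lintegral_lintegral_swap (f := fun v u => k u v)
            (hkm.comp measurable_swap).aemeasurable
      _ = _ := by rw [lintegral_congr hkv, lintegral_const]
  have hk2 : ∀ u u' v, k u v * k u' v ≤
      k u v * (ENNReal.ofReal (Real.exp 4) *
        ENNReal.ofReal (Real.exp (-(|u - u'| / ε) ^ 2))) := by
    intro u u' v
    by_cases hu : |u - v| ≤ ε
    · by_cases hu' : |u' - v| ≤ ε
      · gcongr
        calc k u' v ≤ 1 := Set.indicator_le_self' (fun _ _ => zero_le_one) _
          _ ≤ _ := by
            rw [← ENNReal.ofReal_mul (by positivity), ← Real.exp_add, ENNReal.one_le_ofReal,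
              Real.one_le_exp_iff]
            have h1 : |u - u'| ≤ 2 * ε := by
              have := abs_sub_le u v u'
              rw [abs_sub_comm v u'] at this
              linarith
            have h2 : |u - u'| / ε ≤ 2 := by rwa [div_le_iff₀ hε]
            have h3 : 0 ≤ |u - u'| / ε := by positivity
            nlinarith
      · have : k u' v = 0 := Set.indicator_of_notMem (s := S) hu' _
        rw [this, mul_zero]
        exact zero_le
    · have : k u v = 0 := Set.indicator_of_notMem (s := S) hu _
      rw [this, zero_mul, zero_mul]
  have hG : Measurable fun p : ℝ × ℝ => ENNReal.ofReal (Real.exp 4) *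
      ENNReal.ofReal (Real.exp (-(|p.1 - p.2| / ε) ^ 2)) := by fun_prop
  set H : ℝ → ℝ≥0∞ := fun u => ∫⁻ u', ENNReal.ofReal (Real.exp 4) *
      ENNReal.ofReal (Real.exp (-(|u - u'| / ε) ^ 2)) ∂μ with hH
  have hHm : Measurable H := hG.lintegral_prod_right'
  have hF2 : ∫⁻ v, F v ^ 2 ≤
      ENNReal.ofReal (2 * ε) * (ENNReal.ofReal (Real.exp 4) * (ENNReal.ofReal ε * Q)) := by
    calc ∫⁻ v, F v ^ 2 ≤ ∫⁻ v, (∫⁻ u, k u v * H u ∂μ) := by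
          refine lintegral_mono fun v => ?_
          rw [sq]
          simp only [hF, hH]
          rw [← lintegral_mul_const _ (hkm2 v)]
          refine lintegral_mono fun u => ?_
          rw [← lintegral_const_mul _ (hkm2 v), ← lintegral_const_mul _ (by fun_prop)]
          exact lintegral_mono fun u' => hk2 u u' v
      _ = ∫⁻ u, (∫⁻ v, k u v * H u) ∂μ := by
          refine lintegral_lintegral_swap (f := fun v u => k u v * H u) (Measurable.aemeasurable ?_)
          exact (hkm.comp measurable_swap).mul (hHm.comp measurable_snd)
      _ = ENNReal.ofReal (2 * ε) * ∫⁻ u, H u ∂μ := by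
          rw [← lintegral_const_mul _ hHm]
          refine lintegral_congr fun u => ?_
          rw [lintegral_mul_const _ (hkm1 u), hkv]
      _ ≤ _ := by
          gcongr
          simp only [hH]
          have : ∀ u, ∫⁻ u', ENNReal.ofReal (Real.exp 4) *
              ENNReal.ofReal (Real.exp (-(|u - u'| / ε) ^ 2)) ∂μ = ENNReal.ofReal (Real.exp 4) *
              ∫⁻ u', ENNReal.ofReal (Real.exp (-(|u - u'| / ε) ^ 2)) ∂μ :=
            fun u => lintegral_const_mul _ (by fun_prop)
          simp_rw [this]
          rw [lintegral_const_mul' _ _ ENNReal.ofReal_ne_top]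
          gcongr
          exact lintegral_exp_neg_sq_dist_div_le μ hε
  have key := sq_lintegral_le_measure_mul_lintegral_sq volume hFm
    Metric.isClosed_cthickening.measurableSet hF0
  rw [hFint, mul_pow] at key
  have e0 : ENNReal.ofReal (2 * ε) ^ 2 ≠ 0 := by
    simp [hε]
  have e1 : ENNReal.ofReal (2 * ε) ^ 2 ≠ ∞ := by finiteness
  refine (ENNReal.mul_le_mul_iff_right e0 e1).1 (key.trans ?_)
  calc _ ≤ volume (Metric.cthickening ε K) * (ENNReal.ofReal (2 * ε) *
        (ENNReal.ofReal (Real.exp 4) * (ENNReal.ofReal (2 * ε) * Q))) := by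
        gcongr
        refine hF2.trans ?_
        gcongr
        linarith
    _ = _ := by ring

/-- A compact set carrying a nonzero measure with square integrable Fourier transform has positive
Lebesgue measure. -/
lemma volume_pos_of_lintegral_charFun_sq_ne_top (μ : Measure ℝ) [IsFiniteMeasure μ] (hμ : μ ≠ 0)
    {K : Set ℝ} (hKc : IsCompact K) (hK : μ Kᶜ = 0)
    (hQ : ∫⁻ ξ : ℝ, ‖charFun μ ξ‖ₑ ^ 2 ≠ ∞) : 0 < volume K := by
  rw [pos_iff_ne_zero]
  intro h0
  set D := ENNReal.ofReal (Real.exp 4) * ∫⁻ ξ : ℝ, ‖charFun μ ξ‖ₑ ^ 2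
  have hD : D ≠ ∞ := ENNReal.mul_ne_top ENNReal.ofReal_ne_top hQ
  have hlim : Filter.Tendsto (fun ε => D * volume (Metric.cthickening ε K))
      (nhdsWithin 0 (Set.Ioi 0)) (nhds (D * volume K)) :=
    ENNReal.Tendsto.const_mul ((tendsto_measure_cthickening_of_isCompact hKc).mono_left
      nhdsWithin_le_nhds) (Or.inr hD)
  have h1 : μ Set.univ ^ 2 ≤ D * volume K := ge_of_tendsto hlim (by
    filter_upwards [self_mem_nhdsWithin] with ε hε
    exact sq_measure_univ_le_measure_cthickening μ hK hε)
  rw [h0, mul_zero] at h1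
  have := pow_eq_zero_iff (two_ne_zero) |>.1 (le_antisymm h1 zero_le)
  exact hμ (Measure.measure_univ_eq_zero.1 this)

end EnergyOnLine

section Projection

variable {V : Type*} [NormedAddCommGroup V] [InnerProductSpace ℝ V] [FiniteDimensional ℝ V]
  [MeasurableSpace V] [BorelSpace V]

lemma lintegral_enorm_charFun_sq_mul_dyadic_le (μ : Measure V) [IsFiniteMeasure μ] {s : ℝ}
    {C : ℝ≥0∞} (hμ : ∀ᵐ x ∂μ, ∀ r > 0, μ (Metric.closedBall x r) ≤ C * ENNReal.ofReal (r ^ s))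
    {R : ℝ} (hR : 0 < R) :
    ∫⁻ η : V, ‖charFun μ η‖ₑ ^ 2 * ENNReal.ofReal (Real.exp (-(‖η‖ / R) ^ 2)) ≤
      ENNReal.ofReal (Real.pi ^ (Module.finrank ℝ V / 2 : ℝ) * 2 ^ s) *
        (gaussianSum s * C * μ Set.univ) * ENNReal.ofReal (R ^ (Module.finrank ℝ V - s)) := by
  set d := Module.finrank ℝ V
  have key := lintegral_enorm_charFun_sq_mul_exp μ (b := 1 / R ^ 2) (by positivity)
  have e1 : ∀ η : V, -(1 / R ^ 2) * ‖η‖ ^ 2 = -(‖η‖ / R) ^ 2 := fun η => by ring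
  have e2 : ∀ x x' : V, -(1 / (4 * (1 / R ^ 2))) * ‖x - x'‖ ^ 2 = -(R / 2 * dist x' x) ^ 2 := by
    intro x x'
    rw [dist_comm, dist_eq_norm]
    field_simp
    ring
  simp_rw [e1, e2] at key
  rw [key]
  have h1 : ∫⁻ x, ∫⁻ x', ENNReal.ofReal (Real.exp (-(R / 2 * dist x' x) ^ 2)) ∂μ ∂μ ≤
      ∫⁻ _, gaussianSum s * C * ENNReal.ofReal ((R / 2) ^ (-s)) ∂μ := by
    refine lintegral_mono_ae ?_
    filter_upwards [hμ] with x hx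
    exact lintegral_exp_neg_sq_le μ (g := fun x' => dist x' x) (by fun_prop)
      (fun _ => dist_nonneg) hx (by positivity)
  have e3 : (Real.pi / (1 / R ^ 2)) ^ (d / 2 : ℝ) * (R / 2) ^ (-s) =
      (Real.pi ^ (d / 2 : ℝ) * 2 ^ s) * R ^ (d - s) := by
    rw [div_div_eq_mul_div, div_one, Real.mul_rpow Real.pi_pos.le (by positivity),
      ← Real.rpow_natCast R 2, ← Real.rpow_mul hR.le, Real.div_rpow hR.le (by norm_num),
      Real.rpow_neg (by norm_num : (0 : ℝ) ≤ 2), sub_eq_add_neg, Real.rpow_add hR]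
    push_cast
    rw [mul_div_cancel₀ _ (by norm_num : (2 : ℝ) ≠ 0)]
    field_simp
  rw [lintegral_const] at h1
  calc _ ≤ ENNReal.ofReal ((Real.pi / (1 / R ^ 2)) ^ (d / 2 : ℝ)) *
        (gaussianSum s * C * ENNReal.ofReal ((R / 2) ^ (-s)) * μ Set.univ) := by gcongr
    _ = ENNReal.ofReal ((Real.pi / (1 / R ^ 2)) ^ (d / 2 : ℝ) * (R / 2) ^ (-s)) *
        (gaussianSum s * C * μ Set.univ) := by
        rw [ENNReal.ofReal_mul (by positivity)]
        ring
    _ = _ := by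
        rw [e3, ENNReal.ofReal_mul (by positivity)]
        ring

lemma tsum_lintegral_enorm_charFun_sq_ne_top (μ : Measure V) [IsFiniteMeasure μ] {s t : ℝ}
    {C : ℝ≥0∞} (hC : C ≠ ∞)
    (hμ : ∀ᵐ x ∂μ, ∀ r > 0, μ (Metric.closedBall x r) ≤ C * ENNReal.ofReal (r ^ s))
    (hst : Module.finrank ℝ V < s + t) :
    ∑' j : ℕ, ENNReal.ofReal (((2 : ℝ) ^ j) ^ (-t)) *
      ∫⁻ η : V, ‖charFun μ η‖ₑ ^ 2 * ENNReal.ofReal (Real.exp (-(‖η‖ / 2 ^ j) ^ 2)) ≠ ∞ := by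
  set d := Module.finrank ℝ V
  set D := ENNReal.ofReal (Real.pi ^ (d / 2 : ℝ) * 2 ^ s) * (gaussianSum s * C * μ Set.univ)
  have hD : D ≠ ∞ := ENNReal.mul_ne_top ENNReal.ofReal_ne_top
    (ENNReal.mul_ne_top (ENNReal.mul_ne_top (gaussianSum_ne_top s) hC) (measure_ne_top μ _))
  set q : ℝ≥0∞ := ENNReal.ofReal ((2 : ℝ) ^ (d - s - t))
  have hq : q < 1 := by
    rw [ENNReal.ofReal_lt_one]
    exact Real.rpow_lt_one_of_one_lt_of_neg (by norm_num) (by linarith)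
  have hle : ∀ j : ℕ, ENNReal.ofReal (((2 : ℝ) ^ j) ^ (-t)) *
      ∫⁻ η : V, ‖charFun μ η‖ₑ ^ 2 * ENNReal.ofReal (Real.exp (-(‖η‖ / 2 ^ j) ^ 2)) ≤
      D * q ^ j := by
    intro j
    have h2 : (0 : ℝ) < 2 ^ j := by positivity
    calc _ ≤ ENNReal.ofReal (((2 : ℝ) ^ j) ^ (-t)) *
          (D * ENNReal.ofReal (((2 : ℝ) ^ j) ^ (d - s))) := by
          gcongr
          exact lintegral_enorm_charFun_sq_mul_dyadic_le μ hμ h2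
      _ = D * ENNReal.ofReal (((2 : ℝ) ^ j) ^ (-t) * ((2 : ℝ) ^ j) ^ (d - s)) := by
          rw [ENNReal.ofReal_mul (by positivity)]
          ring
      _ = D * q ^ j := by
          rw [← ENNReal.ofReal_pow (by positivity), ← Real.rpow_add h2, ← Real.rpow_natCast 2 j,
            ← Real.rpow_mul (by norm_num), ← Real.rpow_mul_natCast (by norm_num)]
          congr 3
          ring
  refine ne_top_of_le_ne_top ?_ (ENNReal.tsum_le_tsum hle)
  rw [ENNReal.tsum_mul_left, ENNReal.tsum_geometric]
  exact ENNReal.mul_ne_top hD (ENNReal.inv_ne_top.2 (tsub_pos_of_lt hq).ne')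

lemma exists_volume_image_inner_pos {Y : Type*} [MeasurableSpace Y] (ν : Measure Y)
    [IsFiniteMeasure ν] (hν0 : ν ≠ 0) {ψ : Y → V} (hψ : Measurable ψ) {m : ℝ} (hm : 1 ≤ m)
    {e₁ e₂ : V} (h₁ : ‖e₁‖ ≤ m) (h₂ : ‖e₂‖ ≤ m) (hp : ∀ y, ‖ψ y‖ ≤ m)
    (hp₁ : ∀ y, inner ℝ e₁ (ψ y) = 1) (hp₂ : ∀ y, |inner ℝ e₂ (ψ y)| ≤ m) {s t : ℝ} (ht : 0 ≤ t)
    {C C' : ℝ≥0∞} (hC : C ≠ ∞) (hC' : C' ≠ ∞)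
    (hν : ∀ a, ∀ r > 0, ν {y | |inner ℝ e₂ (ψ y) - a| ≤ r} ≤ C * ENNReal.ofReal (r ^ t))
    (μ : Measure V) [IsFiniteMeasure μ] (hμ0 : μ ≠ 0) {K : Set V} (hK : IsCompact K)
    (hμK : μ Kᶜ = 0)
    (hμ : ∀ x ∈ K, ∀ r > 0, μ (Metric.closedBall x r) ≤ C' * ENNReal.ofReal (r ^ s))
    (hst : Module.finrank ℝ V < s + t) :
    ∃ y, 0 < volume ((fun x => inner ℝ x (ψ y)) '' K) := by
  have hμae : ∀ᵐ x ∂μ, ∀ r > 0, μ (Metric.closedBall x r) ≤ C' * ENNReal.ofReal (r ^ s) := by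
    filter_upwards [show ∀ᵐ x ∂μ, x ∈ K from hμK] with x hx using hμ x hx
  obtain ⟨L, hL, hcone⟩ := lintegral_cone_le ν hψ hm h₁ h₂ hp hp₁ hp₂ ht hC hν
  set c : ℝ≥0∞ := ∫⁻ v : V, ENNReal.ofReal (Real.exp (-(1 / 2) * ‖v‖ ^ 2))
  have hc : c ≠ ∞ := (integrable_exp_neg_mul_sq_norm (by norm_num)).lintegral_lt_top.ne
  have hdm : Measurable fun x : V => ENNReal.ofReal (Real.exp (-(1 / 2) * ‖x‖ ^ 2)) := by fun_prop
  set μ' := μ.withDensity fun x => ENNReal.ofReal (Real.exp (-(1 / 2) * ‖x‖ ^ 2)) with hμ'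
  have hμ'fin : IsFiniteMeasure μ' := by
    refine ⟨?_⟩
    rw [hμ', withDensity_apply _ MeasurableSet.univ, Measure.restrict_univ]
    calc _ ≤ ∫⁻ _, 1 ∂μ := by
          refine lintegral_mono fun x => ?_
          rw [ENNReal.ofReal_le_one, Real.exp_le_one_iff]
          nlinarith [sq_nonneg ‖x‖]
      _ < ∞ := by
          rw [lintegral_one]
          exact measure_lt_top μ _
  have hμ'0 : μ' ≠ 0 := by
    rw [hμ', Ne, withDensity_eq_zero_iff hdm.aemeasurable]
    intro h
    refine hμ0 (ae_eq_bot.1 (Filter.eventually_false_iff_eq_bot.1 ?_))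
    filter_upwards [h] with x hx
    have : 0 < Real.exp (-(1 / 2) * ‖x‖ ^ 2) := Real.exp_pos _
    simp only [Pi.zero_apply, ENNReal.ofReal_eq_zero] at hx
    linarith
  have hμ'K : μ' Kᶜ = 0 := withDensity_absolutelyContinuous _ _ hμK
  have hcm : Measurable (charFun μ) := measurable_charFun
  have hcm' : Measurable (charFun μ') := measurable_charFun
  set G : Y → ℝ≥0∞ := fun y => ∫⁻ r : ℝ, ‖charFun μ' (r • ψ y)‖ₑ ^ 2 with hG
  have hψ2 : Measurable fun p : Y × ℝ => p.2 • ψ p.1 := by fun_prop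
  have hGm2 : Measurable fun p : Y × ℝ => ‖charFun μ' (p.2 • ψ p.1)‖ₑ ^ 2 :=
    (hcm'.comp hψ2).enorm.pow_const 2
  have hGm : Measurable G := hGm2.lintegral_prod_right'
  have hkm : Measurable fun p : (Y × ℝ) × V => ‖charFun μ p.2‖ₑ ^ 2 *
      ENNReal.ofReal (Real.exp (-(1 / 2) * ‖p.2 - p.1.2 • ψ p.1.1‖ ^ 2)) := by fun_prop
  have hkm' : ∀ η : V, Measurable fun p : Y × ℝ =>
      ENNReal.ofReal (Real.exp (-(1 / 2) * ‖η - p.2 • ψ p.1‖ ^ 2)) := fun η => by fun_prop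
  have hGtop : ∫⁻ y, G y ∂ν ≠ ∞ := by
    refine ne_top_of_le_ne_top (ENNReal.mul_ne_top hc (ENNReal.mul_ne_top hL
      (tsum_lintegral_enorm_charFun_sq_ne_top μ hC' hμae hst))) ?_
    calc ∫⁻ y, G y ∂ν = ∫⁻ p : Y × ℝ, ‖charFun μ' (p.2 • ψ p.1)‖ₑ ^ 2 ∂(ν.prod volume) :=
          (lintegral_prod _ hGm2.aemeasurable).symm
      _ ≤ ∫⁻ p : Y × ℝ, c * (∫⁻ η : V, ‖charFun μ η‖ₑ ^ 2 * ENNReal.ofReal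
          (Real.exp (-(1 / 2) * ‖η - p.2 • ψ p.1‖ ^ 2))) ∂(ν.prod volume) :=
          lintegral_mono fun p => enorm_charFun_withDensity_sq_le μ _
      _ = c * ∫⁻ p : Y × ℝ, (∫⁻ η : V, ‖charFun μ η‖ₑ ^ 2 * ENNReal.ofReal
          (Real.exp (-(1 / 2) * ‖η - p.2 • ψ p.1‖ ^ 2))) ∂(ν.prod volume) :=
          lintegral_const_mul' _ _ hc
      _ = c * ∫⁻ η : V, (∫⁻ p : Y × ℝ, ‖charFun μ η‖ₑ ^ 2 * ENNReal.ofReal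
          (Real.exp (-(1 / 2) * ‖η - p.2 • ψ p.1‖ ^ 2)) ∂(ν.prod volume)) := by
          rw [lintegral_lintegral_swap hkm.aemeasurable]
      _ ≤ c * ∫⁻ η : V, L * ∑' j : ℕ, ENNReal.ofReal (((2 : ℝ) ^ j) ^ (-t)) *
          (‖charFun μ η‖ₑ ^ 2 * ENNReal.ofReal (Real.exp (-(‖η‖ / 2 ^ j) ^ 2))) := by
          gcongr with η
          rw [lintegral_const_mul _ (hkm' η), lintegral_prod _ (hkm' η).aemeasurable]
          calc _ ≤ ‖charFun μ η‖ₑ ^ 2 * (L * ∑' j : ℕ, ENNReal.ofReal (((2 : ℝ) ^ j) ^ (-t)) *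
                ENNReal.ofReal (Real.exp (-(‖η‖ / 2 ^ j) ^ 2))) := by
                gcongr
                exact hcone η
            _ = _ := by
                rw [mul_left_comm, ← ENNReal.tsum_mul_left]
                simp_rw [mul_left_comm]
      _ = _ := by
          rw [lintegral_const_mul' _ _ hL, lintegral_tsum (fun j => by fun_prop)]
          congr 3 with j
          exact lintegral_const_mul' _ _ ENNReal.ofReal_ne_top
  have : (ae ν).NeBot := ae_neBot.2 hν0
  obtain ⟨y, hy⟩ := (ae_lt_top hGm hGtop).exists
  refine ⟨y, ?_⟩
  have hcont : Continuous fun x : V => inner ℝ x (ψ y) := by fun_prop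
  set lam := μ'.map fun x => inner ℝ x (ψ y) with hlam
  have hchar : ∀ r : ℝ, charFun lam r = charFun μ' (r • ψ y) := by
    intro r
    rw [charFun_apply_real, charFun_apply, hlam, integral_map hcont.aemeasurable (by fun_prop)]
    simp [inner_smul_right]
  refine volume_pos_of_lintegral_charFun_sq_ne_top lam ?_ (hK.image hcont) ?_ ?_
  · rwa [hlam, Ne, Measure.map_eq_zero_iff hcont.aemeasurable]
  · rw [hlam, Measure.map_apply hcont.measurable (hK.image hcont).measurableSet.compl]
    refine measure_mono_null (t := Kᶜ) (fun x hx hxK => hx ?_) hμ'K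
    exact Set.mem_image_of_mem _ hxK
  · simp_rw [hchar]
    exact hy.ne

end Projection

section Localization

lemma dimH_univ_subtype {X : Type*} [EMetricSpace X] (K : Set X) :
    dimH (Set.univ : Set K) = dimH K := by
  rw [← isometry_subtype_coe.dimH_image, Set.image_univ, Subtype.range_coe]

lemma exists_frostman_measure_of_lt_dimH {X : Type*} [MetricSpace X] [MeasurableSpace X]
    [BorelSpace X] {K : Set X} (hK : IsCompact K) {s : ℝ} (hs : 0 < s)
    (h : ENNReal.ofReal s < dimH K) :
    ∃ μ : Measure K, IsFiniteMeasure μ ∧ μ ≠ 0 ∧ ∀ x, ∀ r : ℝ, 0 < r →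
      μ (Metric.closedBall x r) ≤ ENNReal.ofReal (2 ^ s) * ENNReal.ofReal (r ^ s) := by
  have : CompactSpace K := isCompact_iff_compactSpace.1 hK
  rw [← dimH_univ_subtype] at h
  have h1 := hausdorffMeasure_of_lt_dimH (d := s.toNNReal) h
  rw [Real.coe_toNNReal _ hs.le] at h1
  exact exists_frostman_measure hs (by rw [h1]; exact ENNReal.top_ne_zero)

lemma HasStrictFDerivAt.exists_dist_le_mul_dist {E F : Type*} [NormedAddCommGroup E]
    [NormedSpace ℝ E] [NormedAddCommGroup F] [NormedSpace ℝ F] {f : E → F} {f' : E ≃L[ℝ] F} {a : E}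
    (hf : HasStrictFDerivAt f (f' : E →L[ℝ] F) a) :
    ∃ κ > 0, ∃ s ∈ nhds a, ∀ x ∈ s, ∀ y ∈ s, dist x y ≤ κ * dist (f x) (f y) := by
  obtain ⟨s, has, hs, happ⟩ := hf.approximates_deriv_on_open_nhds
  have h := happ.antilipschitz (by
    refine f'.subsingleton_or_nnnorm_symm_pos.imp id fun h => ?_
    exact NNReal.half_lt_self (inv_pos.2 h).ne')
  set κ := (‖(f'.symm : F →L[ℝ] E)‖₊⁻¹ - ‖(f'.symm : F →L[ℝ] E)‖₊⁻¹ / 2)⁻¹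
  refine ⟨κ + 1, by positivity, s, hs.mem_nhds has, fun x hx y hy => ?_⟩
  have h1 : dist x y ≤ κ * dist (f x) (f y) := h.le_mul_dist ⟨x, hx⟩ ⟨y, hy⟩
  nlinarith [dist_nonneg (x := f x) (y := f y)]

variable {V : Type*} [NormedAddCommGroup V] [InnerProductSpace ℝ V]

lemma exists_dist_le_mul_dist_inner_div {φ : ℝ → V} {φ' : V} {b : ℝ}
    (hφ : HasStrictDerivAt φ φ' b) (hind : LinearIndependent ℝ ![φ b, φ']) :
    ∃ κ > 0, ∃ s ∈ nhds b, ∀ x ∈ s, ∀ y ∈ s, dist x y ≤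
      κ * dist (inner ℝ φ' (φ x) / inner ℝ (φ b) (φ x))
        (inner ℝ φ' (φ y) / inner ℝ (φ b) (φ y)) := by
  have h0 : φ b ≠ 0 := hind.ne_zero 0
  have h0' : φ' ≠ 0 := hind.ne_zero 1
  have hpos : 0 < inner ℝ (φ b) (φ b) := real_inner_self_pos.2 h0
  have hd : ∀ v : V, HasStrictDerivAt (fun y => inner ℝ v (φ y)) (inner ℝ v φ') b := fun v =>
    ((innerSL ℝ v).hasStrictFDerivAt (x := φ b)).comp_hasStrictDerivAt b hφ
  have hdiv := (hd φ').div (hd (φ b)) hpos.ne'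
  have hne : (inner ℝ φ' φ' * inner ℝ (φ b) (φ b) - inner ℝ φ' (φ b) * inner ℝ (φ b) φ') /
      inner ℝ (φ b) (φ b) ^ 2 ≠ 0 := by
    refine div_ne_zero (fun h => ?_) (by positivity)
    have h1 : ‖inner ℝ (φ b) φ'‖ = ‖φ b‖ * ‖φ'‖ := by
      rw [← sq_eq_sq₀ (norm_nonneg _) (by positivity), Real.norm_eq_abs, sq_abs, mul_pow,
        ← real_inner_self_eq_norm_sq, ← real_inner_self_eq_norm_sq]
      rw [real_inner_comm (φ b) φ'] at h
      linarith
    obtain ⟨r, hr, hr'⟩ := (norm_inner_eq_norm_iff h0 h0').1 h1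
    have := (LinearIndependent.pair_iff.1 hind r (-1) (by rw [hr']; simp)).2
    norm_num at this
  exact (hdiv.hasStrictFDerivAt_equiv hne).exists_dist_le_mul_dist

end Localization

section Main

variable {V : Type*} [NormedAddCommGroup V] [InnerProductSpace ℝ V] [FiniteDimensional ℝ V]
  [MeasurableSpace V] [BorelSpace V]

lemma exists_volume_image_inner_pos_of_dimH {K : Set V} (hK : IsCompact K) {B : Set ℝ}
    (hB : IsCompact B) {ψ : ℝ → V} (hψ : ContinuousOn ψ B) {e₁ e₂ : V}
    (h₁ : ∀ y ∈ B, inner ℝ e₁ (ψ y) = 1) {κ : ℝ} (hκ : 0 < κ)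
    (h₂ : ∀ x ∈ B, ∀ y ∈ B, dist x y ≤ κ * dist (inner ℝ e₂ (ψ x)) (inner ℝ e₂ (ψ y))) {s t : ℝ}
    (hs : 0 < s) (ht : 0 < t) (hsK : ENNReal.ofReal s < dimH K) (htB : ENNReal.ofReal t < dimH B)
    (hst : Module.finrank ℝ V < s + t) :
    ∃ y ∈ B, 0 < volume ((fun x => inner ℝ x (ψ y)) '' K) := by
  obtain ⟨μ, hμfin, hμ0, hμ⟩ := exists_frostman_measure_of_lt_dimH hK hs hsK
  obtain ⟨ν, hνfin, hν0, hν⟩ := exists_frostman_measure_of_lt_dimH hB ht htB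
  obtain ⟨M, hM⟩ := hB.exists_bound_of_continuousOn hψ
  set m : ℝ := max 1 (max (max ‖e₁‖ ‖e₂‖) (max M (‖e₂‖ * M))) with hm
  have hψm : Measurable fun y : B => ψ y :=
    (continuousOn_iff_continuous_domRestrict.1 hψ).measurable
  have hKm := hK.measurableSet
  suffices h : ∃ y : B, 0 < volume ((fun x => inner ℝ x (ψ y)) '' K) by
    obtain ⟨y, hy⟩ := h
    exact ⟨y, y.2, hy⟩
  refine exists_volume_image_inner_pos ν hν0 hψm (m := m) (le_max_left _ _)
    (e₁ := e₁) (e₂ := e₂) (by simp [hm]) (by simp [hm])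
    (fun y => (hM y y.2).trans (by simp [hm])) (fun y => h₁ y y.2)
    (fun y => (abs_real_inner_le_norm _ _).trans
      ((mul_le_mul_of_nonneg_left (hM y y.2) (norm_nonneg _)).trans (by simp [hm]))) ht.le
    (C := ENNReal.ofReal (2 ^ t * (2 * κ) ^ t)) (C' := ENNReal.ofReal (2 ^ s))
    ENNReal.ofReal_ne_top ENNReal.ofReal_ne_top ?_ (μ.map Subtype.val) ?_ hK ?_ ?_ hst
  · intro a r hr
    rcases Set.eq_empty_or_nonempty {y : B | |inner ℝ e₂ (ψ y) - a| ≤ r} with h | ⟨y₀, hy₀⟩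
    · rw [h, measure_empty]
      exact zero_le
    · have hsub : {y : B | |inner ℝ e₂ (ψ y) - a| ≤ r} ⊆ Metric.closedBall y₀ (2 * κ * r) := by
        intro y hy
        have e1 := h₂ y y.2 y₀ y₀.2
        have e2 : dist (inner ℝ e₂ (ψ y)) (inner ℝ e₂ (ψ y₀)) ≤ r + r :=
          (dist_triangle_right _ _ a).trans (add_le_add hy hy₀)
        have e3 := mul_le_mul_of_nonneg_left e2 hκ.le
        rw [Metric.mem_closedBall]
        change dist (y : ℝ) y₀ ≤ _
        linarith
      refine (measure_mono hsub).trans ((hν y₀ _ (by positivity)).trans (le_of_eq ?_))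
      rw [← ENNReal.ofReal_mul (by positivity), ← ENNReal.ofReal_mul (by positivity),
        Real.mul_rpow (by positivity) hr.le, mul_assoc]
  · rwa [Ne, Measure.map_eq_zero_iff measurable_subtype_coe.aemeasurable]
  · rw [Measure.map_apply measurable_subtype_coe hKm.compl]
    convert measure_empty (μ := μ)
    ext x
    simp
  · intro x hx r hr
    rw [Measure.map_apply measurable_subtype_coe Metric.isClosed_closedBall.measurableSet]
    exact hμ ⟨x, hx⟩ r hr

end Main

section Curve

variable {V : Type*} [NormedAddCommGroup V] [InnerProductSpace ℝ V]

lemma exists_pos_exponents {n : ℕ} (hn : 1 ≤ n) {a b : ℝ≥0∞} (ha : a ≤ n) (hb : b ≤ 1)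
    (h : (n : ℝ≥0∞) < a + b) :
    ∃ s t : ℝ, 0 < s ∧ 0 < t ∧ ENNReal.ofReal s < a ∧ ENNReal.ofReal t < b ∧ n < s + t := by
  have ha' : a ≠ ∞ := ne_top_of_le_ne_top (ENNReal.natCast_ne_top n) ha
  have hb' : b ≠ ∞ := ne_top_of_le_ne_top ENNReal.one_ne_top hb
  have h1 : (n : ℝ) < a.toReal + b.toReal := by
    rw [← ENNReal.toReal_add ha' hb', ← ENNReal.toReal_natCast]
    exact ENNReal.toReal_strict_mono (ENNReal.add_ne_top.2 ⟨ha', hb'⟩) h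
  have h2 : a.toReal ≤ n := by
    rw [← ENNReal.toReal_natCast]
    exact ENNReal.toReal_mono (ENNReal.natCast_ne_top n) ha
  have h3 : b.toReal ≤ 1 := by
    rw [← ENNReal.toReal_one]
    exact ENNReal.toReal_mono ENNReal.one_ne_top hb
  have h4 : (1 : ℝ) ≤ n := by exact_mod_cast hn
  set δ := a.toReal + b.toReal - n with hδ
  refine ⟨a.toReal - δ / 3, b.toReal - δ / 3, by linarith, by linarith, ?_, ?_, by linarith⟩
  · rw [ENNReal.ofReal_lt_iff_lt_toReal (by linarith) ha']
    linarith
  · rw [ENNReal.ofReal_lt_iff_lt_toReal (by linarith) hb']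
    linarith

lemma exists_continuousLinearEquiv_of_rank_eq [FiniteDimensional ℝ V] (f : V →L[ℝ] V)
    (hf : LinearMap.rank f.toLinearMap = Module.finrank ℝ V) :
    ∃ e : V ≃L[ℝ] V, (e : V →L[ℝ] V) = f := by
  have h1 : Module.finrank ℝ (LinearMap.range f.toLinearMap) = Module.finrank ℝ V := by
    rw [← Module.finrank_eq_of_rank_eq hf]
  have hsurj : Function.Surjective f.toLinearMap :=
    LinearMap.range_eq_top.1 (Submodule.eq_top_of_finrank_eq h1)
  refine ⟨(LinearEquiv.ofBijective f.toLinearMap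
    ⟨LinearMap.injective_iff_surjective.2 hsurj, hsurj⟩).toContinuousLinearEquiv, ?_⟩
  ext x
  rfl

/-- A set of dimension greater than `d` has a compact piece, inside any neighborhood system, whose
image under a local diffeomorphism has dimension greater than `d`. -/
lemma exists_isCompact_lt_dimH_image [FiniteDimensional ℝ V] {U A : Set V} (hU : IsOpen U)
    (hA : IsCompact A) (hAU : A ⊆ U) {P : V → V} (hP : ContDiffOn ℝ 1 P U)
    (hrank : ∀ x ∈ U, LinearMap.rank (fderiv ℝ P x).toLinearMap = Module.finrank ℝ V)
    {d : ℝ≥0∞} (hd : d < dimH A) :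
    ∃ A' ⊆ A, IsCompact (P '' A') ∧ d < dimH (P '' A') := by
  obtain ⟨a, ha, hloc⟩ := exists_mem_nhdsWithin_lt_dimH_of_lt_dimH hd
  have hstrict := (hP.contDiffAt (hU.mem_nhds (hAU ha))).hasStrictFDerivAt one_ne_zero
  obtain ⟨e, he⟩ := exists_continuousLinearEquiv_of_rank_eq _ (hrank a (hAU ha))
  rw [← he] at hstrict
  obtain ⟨κ, hκ, S, hS, hdist⟩ := hstrict.exists_dist_le_mul_dist
  obtain ⟨ρ, hρ, hρS⟩ := Metric.nhds_basis_closedBall.mem_iff.1 hS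
  set A' := A ∩ Metric.closedBall a ρ with hA'
  have hA'A : A' ⊆ A := Set.inter_subset_left
  have hA'c : IsCompact A' := hA.inter_right Metric.isClosed_closedBall
  refine ⟨A', hA'A, hA'c.image_of_continuousOn (hP.continuousOn.mono (hA'A.trans hAU)), ?_⟩
  have hanti : AntilipschitzWith κ.toNNReal (fun x : A' => P x) :=
    AntilipschitzWith.of_le_mul_dist fun x y => by
      rw [Real.coe_toNNReal _ hκ.le]
      exact hdist x (hρS x.2.2) y (hρS y.2.2)
  calc d < dimH A' := hloc _ (Filter.inter_mem self_mem_nhdsWithin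
        (mem_nhdsWithin_of_mem_nhds (Metric.closedBall_mem_nhds a hρ)))
    _ = dimH (Set.univ : Set A') := (dimH_univ_subtype A').symm
    _ ≤ dimH ((fun x : A' => P x) '' Set.univ) := hanti.le_dimH_image _
    _ = dimH (P '' A') := by
        congr 1
        ext z
        simp

open scoped Pointwise in
lemma exists_volume_image_inner_curve_pos [FiniteDimensional ℝ V] [MeasurableSpace V]
    [BorelSpace V] {K : Set V} (hK : IsCompact K) {I B : Set ℝ} (hI : IsOpen I) (hB : IsCompact B)
    (hBI : B ⊆ I) {φ : ℝ → V} (hφ : ContDiffOn ℝ 1 φ I)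
    (hind : ∀ t ∈ I, LinearIndependent ℝ ![φ t, deriv φ t]) {s t : ℝ}
    (hs : 0 < s) (ht : 0 < t) (hsK : ENNReal.ofReal s < dimH K) (htB : ENNReal.ofReal t < dimH B)
    (hst : Module.finrank ℝ V < s + t) :
    ∃ y ∈ B, 0 < volume ((fun x => inner ℝ x (φ y)) '' K) := by
  obtain ⟨b, hb, hloc⟩ := exists_mem_nhdsWithin_lt_dimH_of_lt_dimH htB
  have hbI : I ∈ nhds b := hI.mem_nhds (hBI hb)
  have hstrict := (hφ.contDiffAt hbI).hasStrictDerivAt one_ne_zero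
  have hb0 : 0 < inner ℝ (φ b) (φ b) := real_inner_self_pos.2 ((hind b (hBI hb)).ne_zero 0)
  obtain ⟨κ, hκ, S, hS, hdist⟩ := exists_dist_le_mul_dist_inner_div hstrict (hind b (hBI hb))
  have hcont : ContinuousAt (fun y => inner ℝ (φ b) (φ y)) b :=
    continuousAt_const.inner hstrict.hasDerivAt.continuousAt
  have hpos : {y | 0 < inner ℝ (φ b) (φ y)} ∈ nhds b := hcont.eventually (lt_mem_nhds hb0)
  obtain ⟨ρ, hρ, hρS⟩ := Metric.nhds_basis_closedBall.mem_iff.1 (Filter.inter_mem hS hpos)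
  set B' := B ∩ Metric.closedBall b ρ with hB'
  have hB'B : B' ⊆ B := Set.inter_subset_left
  have hB'c : IsCompact B' := hB.inter_right Metric.isClosed_closedBall
  have hφB : ContinuousOn φ B' := hφ.continuousOn.mono (hB'B.trans hBI)
  have hposB : ∀ y ∈ B', 0 < inner ℝ (φ b) (φ y) := fun y hy => (hρS hy.2).2
  set ψ : ℝ → V := fun y => (inner ℝ (φ b) (φ y))⁻¹ • φ y with hψ
  have hin : ∀ v y, inner ℝ v (ψ y) = inner ℝ v (φ y) / inner ℝ (φ b) (φ y) := by
    intro v y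
    rw [hψ, inner_smul_right, div_eq_inv_mul]
  obtain ⟨y, hy, hvol⟩ := exists_volume_image_inner_pos_of_dimH hK hB'c (ψ := ψ)
    (((continuousOn_const.inner hφB).inv₀ fun y hy => (hposB y hy).ne').smul hφB)
    (e₁ := φ b) (e₂ := deriv φ b)
    (fun y hy => by rw [hin, div_self (hposB y hy).ne']) hκ
    (fun x hx y hy => by
      rw [hin, hin]
      exact hdist x (hρS hx.2).1 y (hρS hy.2).1)
    hs ht hsK (hloc _ (Filter.inter_mem self_mem_nhdsWithin
        (mem_nhdsWithin_of_mem_nhds (Metric.closedBall_mem_nhds b hρ)))) hst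
  refine ⟨y, hB'B hy, pos_iff_ne_zero.2 fun h0 => hvol.ne' ?_⟩
  have himg : (fun x => inner ℝ x (ψ y)) '' K =
      (inner ℝ (φ b) (φ y))⁻¹ • ((fun x => inner ℝ x (φ y)) '' K) := by
    rw [← Set.image_smul, Set.image_image]
    simp_rw [hin, div_eq_inv_mul, smul_eq_mul]
  rw [himg, Measure.addHaar_smul, h0, mul_zero]

end Curve

/-- for `f(x,y) = Σ P_k(x) φ_k(y)` with `P` smooth of rank `n` on `U` and `φ` a
smooth nonvanishing curve with `φ'(t)` not parallel to `φ(t)`, if `A ⊆ U`, `B ⊆ I` are compact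
with `dim_H A + dim_H B > n`, then `f(A,y)` has positive Lebesgue measure for some `y ∈ B`. -/
theorem stmt_3 (n : ℕ) (hn : 2 ≤ n)
    (U : Set (EuclideanSpace ℝ (Fin n))) (I : Set ℝ) (hU : IsOpen U) (hI : IsOpen I)
    (P : EuclideanSpace ℝ (Fin n) → EuclideanSpace ℝ (Fin n))
    (φ : ℝ → EuclideanSpace ℝ (Fin n))
    (hP : ContDiffOn ℝ (⊤ : ℕ∞) P U)
    (hφ : ContDiffOn ℝ (⊤ : ℕ∞) φ I)
    (hPrank : ∀ x ∈ U, LinearMap.rank (fderiv ℝ P x).toLinearMap = n)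
    (hφ0 : ∀ t ∈ I, φ t ≠ 0)
    (hind : ∀ t ∈ I, LinearIndependent ℝ ![φ t, deriv φ t])
    (A : Set (EuclideanSpace ℝ (Fin n))) (B : Set ℝ)
    (hA : IsCompact A) (hB : IsCompact B) (hAU : A ⊆ U) (hBI : B ⊆ I)
    (hdim : dimH A + dimH B > (n : ℝ≥0∞)) :
    ∃ y ∈ B, 0 < volume ((fun x => ∑ k, P x k * φ y k) '' A) := by
  have hfin : Module.finrank ℝ (EuclideanSpace ℝ (Fin n)) = n := finrank_euclideanSpace_fin
  obtain ⟨s, t, hs, ht, hsA, htB, hst⟩ := exists_pos_exponents (n := n) (by omega)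
    (by simpa [Real.dimH_univ_eq_finrank] using dimH_mono (Set.subset_univ A))
    (by simpa [Real.dimH_univ] using dimH_mono (Set.subset_univ B)) hdim
  have h1 : (1 : WithTop ℕ∞) ≤ ((⊤ : ℕ∞) : WithTop ℕ∞) := by exact_mod_cast le_top
  obtain ⟨A', hA'A, hK, hsK⟩ := exists_isCompact_lt_dimH_image hU hA hAU (hP.of_le h1)
    (by rwa [hfin]) hsA
  obtain ⟨y, hy, hvol⟩ := exists_volume_image_inner_curve_pos hK hI hB hBI (hφ.of_le h1) hind
    hs ht hsK htB (by rwa [hfin])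
  refine ⟨y, hy, hvol.trans_le (measure_mono ?_)⟩
  rintro _ ⟨_, ⟨x, hx, rfl⟩, rfl⟩
  refine ⟨x, hA'A hx, ?_⟩
  simp [PiLp.inner_apply, mul_comm]
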